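/- arXiv:1602.02613 — 2 statements merged into one kernel-verified Lean document; each statement's English description precedes it below -/
import Mathlib

section
/- Let T be a minimal 3-interval exchange transformation which is not of rotation type. Then T has an n-th root in 𝔾 for some n ≥ 2 (i.e., there exist an IET S and n ≥ 2 with S^n = T) if and only if T fails to satisfy the infinite distinct orbit condition. -/
open Set

namespace IETRoots

noncomputable section

/-- The unit interval `[0,1)`, the domain of our interval exchange transformations. -/
def unitI : Set ℝ := Set.Ico 0 1

/-- `T : ℝ → ℝ` is (the extension by the identity of) an interval exchange
transformation: it fixes the complement of `[0,1)`, maps `[0,1)` bijectively onto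
itself, and there is a finite partition of `[0,1)` into half-open intervals on each
of which `T` is a translation.  The group `𝔾` of IETs is the set of such maps under
composition. -/
def IsIET (T : ℝ → ℝ) : Prop :=
  Set.BijOn T unitI unitI ∧ (∀ x, x ∉ unitI → T x = x) ∧
  ∃ (k : ℕ) (β : Fin (k + 1) → ℝ), StrictMono β ∧ β 0 = 0 ∧ β (Fin.last k) = 1 ∧
    ∀ i : Fin k, ∃ c : ℝ, ∀ x ∈ Set.Ico (β i.castSucc) (β i.succ), T x = x + c

/-- The `ℤ`-orbit `{T^n x : n ∈ ℤ}` of `x` under the bijection `T`. -/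
def orbitZ (T : ℝ → ℝ) (x : ℝ) : Set ℝ := {y | ∃ n : ℕ, T^[n] x = y ∨ T^[n] y = x}

/-- `T` is minimal: every orbit is dense in `[0,1)`. -/
def IsMinimal (T : ℝ → ℝ) : Prop := ∀ x ∈ unitI, unitI ⊆ closure (orbitZ T x)

/-- `T` is of rotation type: `T x = x + α (mod 1)` on `[0,1)`. -/
def IsRotationType (T : ℝ → ℝ) : Prop := ∃ α : ℝ, ∀ x ∈ unitI, T x = Int.fract (x + α)

/-- `T` has an `n`-th root in the group `𝔾` of IETs for some `n ≥ 2`. -/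
def HasNontrivialRoot (T : ℝ → ℝ) : Prop :=
  ∃ (S : ℝ → ℝ) (n : ℕ), IsIET S ∧ 2 ≤ n ∧ S^[n] = T

/-- The set `D(T)` of points of `[0,1)` at which `T` is discontinuous
(as a map of `[0,1)`). -/
def DiscSet (T : ℝ → ℝ) : Set ℝ := {x | x ∈ unitI ∧ ¬ ContinuousWithinAt T unitI x}

/-- `β_j = λ_1 + ⋯ + λ_j` (`0`-indexed: the sum of the first `j` lengths). -/
def betaPt {m : ℕ} (lam : Fin m → ℝ) (j : ℕ) : ℝ :=
  ∑ i ∈ Finset.univ.filter (fun i : Fin m => (i : ℕ) < j), lam i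

/-- The interval exchange transformation `T_{(π,λ)}` determined by a permutation
`π ∈ S_m` and a length vector `λ`: on `I_j = [β_{j-1}, β_j)` it is given by
`x ↦ x - ∑_{i<j} λ_i + ∑_{π(i)<π(j)} λ_i`; outside `[0,1)` it is the identity. -/
noncomputable def ietMap {m : ℕ} (π : Equiv.Perm (Fin m)) (lam : Fin m → ℝ) : ℝ → ℝ :=
  fun x =>
    if h : ∃ j : Fin m, x ∈ Set.Ico (betaPt lam (j : ℕ)) (betaPt lam (j : ℕ) + lam j) then
      x - betaPt lam (h.choose : ℕ) +
        ∑ i ∈ Finset.univ.filter (fun i : Fin m => π i < π h.choose), lam i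
    else x

/-- A permutation `π ∈ S_m` is separating if `π(i+1) ≠ π(i) + 1` for `1 ≤ i ≤ m-1`. -/
def Separating {m : ℕ} (π : Equiv.Perm (Fin m)) : Prop :=
  ∀ i j : Fin m, (j : ℕ) = (i : ℕ) + 1 → (π j : ℕ) ≠ (π i : ℕ) + 1

/-- A permutation `π ∈ S_m` is irreducible if `π({1,…,k}) ≠ {1,…,k}` for all `k < m`. -/
def IrreduciblePerm {m : ℕ} (π : Equiv.Perm (Fin m)) : Prop :=
  ∀ k : ℕ, 1 ≤ k → k < m → ∃ i : Fin m, (i : ℕ) < k ∧ k ≤ (π i : ℕ)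

/-- The endpoints `0 = γ_0 < γ_1 < ⋯ < γ_{m-1} < γ_m = 1`, namely the discontinuities
of `T` together with `0` and `1`. -/
def endpointsOf (T : ℝ → ℝ) : Set ℝ := insert 0 (insert 1 (DiscSet T))

/-- The set of lengths `l_j = γ_j - γ_{j-1}` of the intervals of continuity of `T`,
i.e. the gaps between consecutive endpoints. -/
def gapLengths (T : ℝ → ℝ) : Set ℝ :=
  {l | ∃ a ∈ endpointsOf T, ∃ b ∈ endpointsOf T,
        a < b ∧ (∀ c ∈ endpointsOf T, ¬(a < c ∧ c < b)) ∧ l = b - a}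

/-- The rank of `T`: the dimension of the `ℚ`-vector space spanned by the lengths
`l_1, …, l_m`. -/
noncomputable def ietRank (T : ℝ → ℝ) : ℕ :=
  Module.finrank ℚ (Submodule.span ℚ (gapLengths T))

/-- Keane's infinite distinct orbit condition for an `m`-IET `T = T_{(π,λ)}`:
the orbits of `β_1, …, β_{m-1}` are infinite and pairwise disjoint. -/
def SatisfiesIDOC {m : ℕ} (lam : Fin m → ℝ) (T : ℝ → ℝ) : Prop :=
  (∀ j : ℕ, 1 ≤ j → j ≤ m - 1 → (orbitZ T (betaPt lam j)).Infinite) ∧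
  ∀ j j' : ℕ, 1 ≤ j → j ≤ m - 1 → 1 ≤ j' → j' ≤ m - 1 → j ≠ j' →
    orbitZ T (betaPt lam j) ∩ orbitZ T (betaPt lam j') = ∅

/-- A rotation: a `2`-IET with permutation `(21)`, i.e. `x ↦ x + α (mod 1)`
with `α ∈ (0,1)`. -/
def IsRotation (S : ℝ → ℝ) : Prop :=
  (∀ x, x ∉ unitI → S x = x) ∧ ∃ α ∈ Set.Ioo (0 : ℝ) 1, ∀ x ∈ unitI, S x = Int.fract (x + α)

/-- Conjugacy in the group `𝔾` of IETs. -/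
def IsConjugate (T T' : ℝ → ℝ) : Prop := ∃ g : ℝ → ℝ, IsIET g ∧ g ∘ T = T' ∘ g

/-- `T` is a tower of type `(n_1, …, n_k)` over the `k`-IET `S`:  there is a partition
`0 = t_0 < t_1 < ⋯ < t_k = 1` into intervals `I_i` on which `S` is a translation, a
scaling factor `c > 0`, and for each `i` a family of `n_i` pairwise disjoint "levels"
(scaled copies of `I_i`) which together partition `[0,1)`, such that `T` translates each
level of the `i`-th column onto the next one, and maps the top level back to the bottom
levels according to `S` (all after rescaling by `c`). -/
def IsTowerOver {k : ℕ} (T : ℝ → ℝ) (n : Fin k → ℕ) (S : ℝ → ℝ) : Prop :=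
  IsIET T ∧ IsIET S ∧ (∀ i, 0 < n i) ∧
  ∃ (t : Fin (k + 1) → ℝ) (c : ℝ) (a : Fin k → ℕ → ℝ),
    StrictMono t ∧ t 0 = 0 ∧ t (Fin.last k) = 1 ∧ 0 < c ∧
    (∀ i : Fin k, ∃ d : ℝ, ∀ x ∈ Set.Ico (t i.castSucc) (t i.succ), S x = x + d) ∧
    (∀ i : Fin k, ∀ j : ℕ, j < n i →
      Set.Ico (a i j) (a i j + c * (t i.succ - t i.castSucc)) ⊆ unitI) ∧
    (∀ i i' : Fin k, ∀ j j' : ℕ, j < n i → j' < n i' → (i, j) ≠ (i', j') →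
      Disjoint (Set.Ico (a i j) (a i j + c * (t i.succ - t i.castSucc)))
        (Set.Ico (a i' j') (a i' j' + c * (t i'.succ - t i'.castSucc)))) ∧
    (∀ y ∈ unitI, ∃ (i : Fin k) (j : ℕ), j < n i ∧
      y ∈ Set.Ico (a i j) (a i j + c * (t i.succ - t i.castSucc))) ∧
    (∀ i : Fin k, ∀ j : ℕ, j + 1 < n i → ∀ x ∈ Set.Ico (t i.castSucc) (t i.succ),
      T (a i j + c * (x - t i.castSucc)) = a i (j + 1) + c * (x - t i.castSucc)) ∧
    (∀ i : Fin k, ∀ x ∈ Set.Ico (t i.castSucc) (t i.succ), ∀ i' : Fin k,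
      S x ∈ Set.Ico (t i'.castSucc) (t i'.succ) →
      T (a i (n i - 1) + c * (x - t i.castSucc)) = a i' 0 + c * (S x - t i'.castSucc))

/-- The data of the first return map of `T` to `J = [a,b)`: a partition
`a = s_0 < s_1 < ⋯ < s_k = b` of `J`, return times `mt_i ≥ 1` and translation
constants `c_i` such that for `x` in the `i`-th piece the iterates `T^j x`, `0 < j < mt_i`,
avoid `J`, while `T^{mt_i} x = x + c_i ∈ J`.  Thus the first return map `T_J` is the
`k`-IET `x ↦ x + c_i` on the `i`-th piece. -/
def IsFirstReturnSystem (T : ℝ → ℝ) (a b : ℝ) {k : ℕ} (s : Fin (k + 1) → ℝ)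
    (mt : Fin k → ℕ) (c : Fin k → ℝ) : Prop :=
  StrictMono s ∧ s 0 = a ∧ s (Fin.last k) = b ∧
  ∀ i : Fin k, 0 < mt i ∧ ∀ x ∈ Set.Ico (s i.castSucc) (s i.succ),
    (∀ j : ℕ, 0 < j → j < mt i → T^[j] x ∉ Set.Ico a b) ∧
    T^[mt i] x ∈ Set.Ico a b ∧ T^[mt i] x = x + c i

/-- A finite sequence `x_0, …, x_k` is an `S`-chain if `x_0` and `x_k` lie in
`D(S) ∪ {0}` and `S x_i = x_{i+1}`. -/
def IsSChainSeq (S : ℝ → ℝ) {k : ℕ} (x : Fin (k + 1) → ℝ) : Prop :=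
  x 0 ∈ insert (0 : ℝ) (DiscSet S) ∧ x (Fin.last k) ∈ insert (0 : ℝ) (DiscSet S) ∧
  ∀ i : Fin k, S (x i.castSucc) = x i.succ

/-- A set `C ⊆ ℝ` is (the underlying set of) an `S`-chain. -/
def IsSChain (S : ℝ → ℝ) (C : Set ℝ) : Prop :=
  ∃ (k : ℕ) (x : Fin (k + 1) → ℝ), IsSChainSeq S x ∧ C = Set.range x

/-- A maximal `S`-chain: an `S`-chain which is not a proper subset of another `S`-chain. -/
def IsMaximalSChain (S : ℝ → ℝ) (C : Set ℝ) : Prop :=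
  IsSChain S C ∧ ∀ C', IsSChain S C' → C ⊆ C' → C = C'

/-- The open simplex `Δ_m ⊆ ℝ^m`. -/
def simplexSet (m : ℕ) : Set (Fin m → ℝ) := {lam | (∀ i, 0 < lam i) ∧ ∑ i, lam i = 1}

/-- The affine chart identifying (a superset of) `Δ_m` with a subset of `ℝ^{m-1}`:
`λ_i = x_i` for `i < m-1` and `λ_{m-1} = 1 - ∑ x_j`.  Lebesgue measure on `Δ_m`
is the `(m-1)`-dimensional Lebesgue measure carried through this chart. -/
def chartMap (m : ℕ) (x : Fin (m - 1) → ℝ) : Fin m → ℝ := fun i =>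
  if h : (i : ℕ) < m - 1 then x ⟨(i : ℕ), h⟩ else 1 - ∑ j, x j

/-- The permutation `(321) ∈ S_3`, sending `1 ↦ 3`, `2 ↦ 2`, `3 ↦ 1`. -/
def perm321 : Equiv.Perm (Fin 3) :=
  ⟨fun i => i.rev, fun i => i.rev, fun i => Fin.rev_rev i, fun i => Fin.rev_rev i⟩

end


/-! ### The explicit (321) map as a permutation of `ℝ` -/

/-- Explicit form of the 3-IET with permutation (321). -/
noncomputable def tmap (a b c x : ℝ) : ℝ :=
  if x < 0 then x else if x < a then x + (b + c) else if x < a + b then x + (c - a)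
  else if x < 1 then x - (a + b) else x

/-- Explicit inverse. -/
noncomputable def tinv (a b c x : ℝ) : ℝ :=
  if x < 0 then x else if x < c then x + (a + b) else if x < c + b then x - (c - a)
  else if x < 1 then x - (b + c) else x

/-- The map as a permutation of the line. -/
noncomputable def T3 (a b c : ℝ) (ha : 0 < a) (hb : 0 < b) (hc : 0 < c) (h1 : a + b + c = 1) :
    Equiv.Perm ℝ where
  toFun := tmap a b c
  invFun := tinv a b c
  left_inv := by
    intro x
    unfold tmap tinv
    split_ifs <;> linarith
  right_inv := by
    intro x
    unfold tmap tinv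
    split_ifs <;> linarith

section basics
variable {a b c : ℝ} (ha : 0 < a) (hb : 0 < b) (hc : 0 < c) (h1 : a + b + c = 1)

theorem T3_apply (x : ℝ) : T3 a b c ha hb hc h1 x = tmap a b c x := rfl

theorem T3_mem (x : ℝ) : T3 a b c ha hb hc h1 x ∈ unitI ↔ x ∈ unitI := by
  rw [T3_apply]
  unfold tmap unitI
  simp only [Set.mem_Ico]
  split_ifs <;> constructor <;> rintro ⟨h, h'⟩ <;> constructor <;> linarith

theorem T3_zmem (m : ℤ) (x : ℝ) : (T3 a b c ha hb hc h1 ^ m) x ∈ unitI ↔ x ∈ unitI := by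
  induction m using Int.induction_on generalizing x with
  | zero => simp
  | succ i ih => rw [zpow_add_one, Equiv.Perm.mul_apply, ih, T3_mem]
  | pred i ih =>
    rw [zpow_sub_one, Equiv.Perm.mul_apply, ih, ← T3_mem ha hb hc h1]
    simp

theorem T3_not_mem {x : ℝ} (hx : x ∉ unitI) : T3 a b c ha hb hc h1 x = x := by
  rw [T3_apply]
  unfold tmap
  unfold unitI at hx
  simp only [Set.mem_Ico, not_and, not_lt] at hx
  split_ifs with h1 h2 h3 h4
  · rfl
  · exact absurd (hx (by linarith)) (by linarith)
  · exact absurd (hx (by linarith)) (by linarith)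
  · exact absurd (hx (by linarith)) (by linarith)
  · rfl

/-- displacement -/
theorem T3_cases {x : ℝ} (hx : x ∈ unitI) :
    (x < a ∧ T3 a b c ha hb hc h1 x = x + (b + c)) ∨
    (a ≤ x ∧ x < a + b ∧ T3 a b c ha hb hc h1 x = x + (c - a)) ∨
    (a + b ≤ x ∧ T3 a b c ha hb hc h1 x = x - (a + b)) := by
  rw [T3_apply]
  unfold tmap
  unfold unitI at hx
  simp only [Set.mem_Ico] at hx
  obtain ⟨h0, h01⟩ := hx
  rw [if_neg (by linarith)]
  split_ifs with h1 h2
  · left; exact ⟨h1, rfl⟩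
  · right; left; exact ⟨by linarith, h2, rfl⟩
  · right; right; exact ⟨by linarith, rfl⟩

theorem orbit_iff (T : Equiv.Perm ℝ) (x y : ℝ) : y ∈ orbitZ T x ↔ ∃ m : ℤ, (T ^ m) x = y := by
  unfold orbitZ
  simp only [Set.mem_ofPred_eq, ← Equiv.Perm.coe_pow]
  constructor
  · rintro ⟨n, h | h⟩
    · exact ⟨n, by simpa using h⟩
    · refine ⟨-n, ?_⟩
      rw [← h]
      simp
  · rintro ⟨m, rfl⟩
    obtain ⟨n, rfl | rfl⟩ := m.eq_nat_or_neg
    · exact ⟨n, Or.inl (by simp)⟩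
    · exact ⟨n, Or.inr (by simp)⟩

theorem not_finite_orbit {T : ℝ → ℝ} (hmin : IsMinimal T) {x : ℝ} (hx : x ∈ unitI) :
    (orbitZ T x).Infinite := by
  intro hf
  have := hmin x hx
  rw [hf.isClosed.closure_eq] at this
  exact (Set.Ico_infinite (zero_lt_one (α := ℝ))) (hf.subset this)

theorem aperiodic {T : Equiv.Perm ℝ} (hmin : IsMinimal T) {x : ℝ} (hx : x ∈ unitI) (m : ℤ)
    (h : (T ^ m) x = x) : m = 0 := by
  by_contra hm
  apply not_finite_orbit hmin hx
  have : orbitZ T x ⊆ (fun j : ℤ => (T ^ j) x) '' (Set.Ico 0 |m|) := by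
    intro y hy
    rw [orbit_iff] at hy
    obtain ⟨j, rfl⟩ := hy
    refine ⟨j % m, ⟨Int.emod_nonneg _ hm, Int.emod_lt_abs _ hm⟩, ?_⟩
    have e : j = j % m + m * (j / m) := (Int.emod_add_mul_ediv j m).symm
    conv_rhs => rw [e]
    simp only
    rw [zpow_add, zpow_mul, Equiv.Perm.mul_apply]
    congr 1
    exact (Equiv.Perm.zpow_apply_eq_self_of_apply_eq_self h _).symm
  exact ((Set.finite_Ico 0 |m|).image _).subset this

end basics

/-! ### No roots under the IDOC -/

open Filter Topology in
/-- Left germ at `x` is translated to the left germ at `y`. -/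
def LV (f : ℝ → ℝ) (x y : ℝ) : Prop := ∀ᶠ δ in 𝓝[>] (0:ℝ), f (x - δ) = y - δ

section forward
open Filter Topology

theorem LV.comp {f g : ℝ → ℝ} {x y z : ℝ} (hg : LV g y z) (hf : LV f x y) :
    LV (fun t => g (f t)) x z := by
  unfold LV at *
  filter_upwards [hf, hg] with δ h1 h2
  rw [h1, h2]

theorem LV.unique {f : ℝ → ℝ} {x y z : ℝ} (h : LV f x y) (h' : LV f x z) : y = z := by
  obtain ⟨δ, h1, h2⟩ := (Filter.Eventually.and h h').exists
  linarith

theorem small {r : ℝ} (hr : 0 < r) : ∀ᶠ δ in 𝓝[>] (0:ℝ), 0 < δ ∧ δ < r := by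
  filter_upwards [Ioo_mem_nhdsGT hr] with δ h using h

theorem exists_piece {k : ℕ} (β : Fin (k + 1) → ℝ) (x : ℝ)
    (h0 : β 0 ≤ x) (h1 : x < β (Fin.last k)) :
    ∃ i : Fin k, x ∈ Set.Ico (β i.castSucc) (β i.succ) := by
  induction k with
  | zero => exact absurd h0 (not_le.mpr h1)
  | succ k ih =>
    by_cases h : x < β (Fin.last k).castSucc
    · obtain ⟨i, hi⟩ := ih (fun i => β i.castSucc) h0 h
      exact ⟨i.castSucc, hi⟩
    · exact ⟨Fin.last k, not_lt.mp h, h1⟩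

theorem IsIET.LV {S : ℝ → ℝ} (hS : IsIET S) :
    ∃ F : Set ℝ, F.Finite ∧ ∀ x ∈ unitI, x ∉ F → LV S x (S x) := by
  obtain ⟨-, -, k, β, hβ, h0, h1, hc⟩ := hS
  refine ⟨Set.range β, Set.finite_range β, ?_⟩
  intro x hx hxF
  obtain ⟨i, hi⟩ := exists_piece β x (by rw [h0]; exact hx.1) (by rw [h1]; exact hx.2)
  obtain ⟨d, hd⟩ := hc i
  have hlt : β i.castSucc < x := lt_of_le_of_ne hi.1 (fun h => hxF ⟨_, h⟩)
  unfold IETRoots.LV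
  filter_upwards [small (sub_pos.mpr hlt)] with δ hδ
  rw [hd x hi, hd (x - δ) ⟨by linarith, by linarith [hi.2]⟩]
  ring

variable {a b c : ℝ} (ha : 0 < a) (hb : 0 < b) (hc : 0 < c) (h1 : a + b + c = 1)

/-- continuity points -/
def Good (a b x : ℝ) : Prop := 0 < x ∧ x < 1 ∧ x ≠ a ∧ x ≠ a + b

theorem LV_good {x : ℝ} (hx : Good a b x) :
    LV (T3 a b c ha hb hc h1) x (T3 a b c ha hb hc h1 x) := by
  obtain ⟨h0, h1', h2, h3⟩ := hx
  unfold LV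
  simp only [T3_apply]
  rcases lt_trichotomy x a with h | h | h
  · filter_upwards [small h0] with δ hδ
    unfold tmap
    split_ifs <;> linarith
  · exact absurd h h2
  · rcases lt_trichotomy x (a + b) with h' | h' | h'
    · filter_upwards [small (sub_pos.mpr h)] with δ hδ
      unfold tmap
      split_ifs <;> linarith
    · exact absurd h' h3
    · filter_upwards [small (sub_pos.mpr h')] with δ hδ
      unfold tmap
      split_ifs <;> linarith

theorem LV_pow (m : ℕ) (x : ℝ) (h : ∀ i < m, Good a b ((T3 a b c ha hb hc h1 ^ (i : ℤ)) x)) :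
    LV (T3 a b c ha hb hc h1 ^ m : Equiv.Perm ℝ) x ((T3 a b c ha hb hc h1 ^ m : Equiv.Perm ℝ) x) := by
  induction m with
  | zero =>
    unfold LV
    simp
  | succ m ih =>
    have := (LV_good ha hb hc h1 (h m (by omega))).comp (by simpa using ih (fun i hi => h i (by omega)))
    rw [pow_succ']
    rw [zpow_natCast] at this
    exact this

theorem LV_a : LV (T3 a b c ha hb hc h1 ^ 2 : Equiv.Perm ℝ) a (T3 a b c ha hb hc h1 a) := by
  have e1 : LV (T3 a b c ha hb hc h1) a 1 := by
    unfold LV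
    simp only [T3_apply]
    filter_upwards [small ha] with δ hδ
    unfold tmap
    split_ifs <;> linarith
  have e2 : LV (T3 a b c ha hb hc h1) 1 (T3 a b c ha hb hc h1 a) := by
    unfold LV
    simp only [T3_apply]
    filter_upwards [small hc] with δ hδ
    unfold tmap
    split_ifs <;> linarith
  exact e2.comp e1

theorem T3_b : T3 a b c ha hb hc h1 (a + b) = 0 := by
  simp only [T3_apply]
  unfold tmap
  split_ifs <;> linarith

theorem T3_0 : T3 a b c ha hb hc h1 0 = b + c := by
  simp only [T3_apply]
  unfold tmap
  split_ifs <;> linarith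

theorem LV_b : LV (T3 a b c ha hb hc h1) (a + b)
    ((T3 a b c ha hb hc h1 ^ (2:ℤ)) (a + b)) := by
  have : (T3 a b c ha hb hc h1 ^ (2:ℤ)) (a + b) = b + c := by
    have : (T3 a b c ha hb hc h1 ^ (2:ℤ)) = T3 a b c ha hb hc h1 * T3 a b c ha hb hc h1 := by
      rw [zpow_two]
    rw [this, Equiv.Perm.mul_apply, T3_b, T3_0]
  rw [this]
  unfold LV
  simp only [T3_apply]
  filter_upwards [small hb] with δ hδ
  unfold tmap
  split_ifs <;> linarith

theorem forward_aux
    (hap : ∀ x ∈ unitI, ∀ m : ℤ, (T3 a b c ha hb hc h1 ^ m) x = x → m = 0)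
    (hdis : ∀ m : ℤ, (T3 a b c ha hb hc h1 ^ m) a ≠ a + b)
    (S : ℝ → ℝ) (n : ℕ) (hS : IsIET S) (hn : 2 ≤ n)
    (hST : S^[n] = T3 a b c ha hb hc h1) : False := by
  set T := T3 a b c ha hb hc h1 with hT
  have haI : a ∈ unitI := ⟨ha.le, by linarith⟩
  have hbI : a + b ∈ unitI := ⟨by linarith, by linarith⟩
  have hcan : ∀ x ∈ unitI, ∀ m m' : ℤ, (T ^ m) x = (T ^ m') x → m = m' := by
    intro x hx m m' h
    have : (T ^ (m - m')) x = x := by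
      rw [sub_eq_neg_add, zpow_add, Equiv.Perm.mul_apply, h]
      simp
    have := hap x hx _ this
    omega
  have hinv : ∀ (x y : ℝ) (m : ℤ), (T ^ m) x = y → (T ^ (-m)) y = x := by
    intro x y m h
    rw [← h]; simp
  -- S as a permutation commuting with T
  have hSb : Function.Bijective S := by
    have hb : Function.Bijective S^[n] := by rw [hST]; exact T.bijective
    have en : n = (n - 1) + 1 := by omega
    constructor
    · have := hb.1
      rw [en, Function.iterate_succ] at this
      exact this.of_comp
    · have := hb.2
      rw [en, Function.iterate_succ'] at this
      exact this.of_comp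
  obtain ⟨P, hP⟩ : ∃ P : Equiv.Perm ℝ, ⇑P = S := ⟨Equiv.ofBijective S hSb, rfl⟩
  have hPT : P ^ n = T := by
    ext x
    rw [Equiv.Perm.coe_pow, hP, hST]
  have hcomm : ∀ (m : ℤ) (x : ℝ), S ((T ^ m) x) = (T ^ m) (S x) := by
    intro m x
    have : Commute P (T ^ m) := by
      rw [← hPT]
      exact ((Commute.refl P).pow_right n).zpow_right m
    rw [← hP]
    exact congrArg (fun f : Equiv.Perm ℝ => f x) this.eq
  -- zeros and good points
  have hgood : ∀ x ∈ unitI, x ≠ a → x ≠ a + b → (T ^ (-1 : ℤ)) x ≠ a + b → Good a b x := by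
    intro x hx h h' h''
    refine ⟨lt_of_le_of_ne hx.1 ?_, hx.2, h, h'⟩
    rintro rfl
    apply h''
    apply hinv (a + b) 0 1
    rw [zpow_one]
    exact T3_b ha hb hc h1
  have hzz : ∀ (i j : ℤ) (x : ℝ), (T ^ i) ((T ^ j) x) = (T ^ (i + j)) x := by
    intro i j x; rw [zpow_add, Equiv.Perm.mul_apply]
  have hz1 : ∀ (j : ℤ) (x : ℝ), T ((T ^ j) x) = (T ^ (1 + j)) x := by
    intro j x; rw [zpow_add, Equiv.Perm.mul_apply, zpow_one]
  have hgoodA : ∀ i : ℤ, i ≠ 0 → Good a b ((T ^ i) a) := by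
    intro i hi
    apply hgood _ ((T3_zmem ha hb hc h1 i a).mpr haI)
    · intro h; exact hi (hap a haI i h)
    · exact hdis i
    · rw [hzz]; exact hdis _
  have hgoodB : ∀ i : ℤ, i ≠ 0 → i ≠ 1 → Good a b ((T ^ i) (a + b)) := by
    intro i hi hi'
    apply hgood _ ((T3_zmem ha hb hc h1 i _).mpr hbI)
    · intro h; exact hdis _ (hinv _ _ _ h)
    · intro h; exact hi (hap _ hbI i h)
    · rw [hzz]; intro h
      have := hap _ hbI _ h
      omega
  -- S is continuous far out in the orbit of a
  obtain ⟨F, hF, hSF⟩ := hS.LV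
  obtain ⟨J, hJ⟩ : ∃ J : ℕ, ∀ j : ℤ, (J : ℤ) ≤ |j| → (T ^ j) a ∉ F := by
    have hfin : {j : ℤ | (T ^ j) a ∈ F}.Finite :=
      hF.preimage (fun x _ y _ h => hcan a haI _ _ h)
    have hfin2 := hfin.image (fun j : ℤ => j.natAbs)
    obtain ⟨B, hB⟩ := hfin2.bddAbove
    refine ⟨B + 1, fun j hj hjF => ?_⟩
    have := hB ⟨j, hjF, rfl⟩
    simp only at this
    rw [Int.abs_eq_natAbs] at hj
    omega
  have hLSa : ∀ j : ℤ, (J : ℤ) ≤ |j| → LV S ((T ^ j) a) ((T ^ j) (S a)) := by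
    intro j hj
    rw [← hcomm]
    exact hSF _ ((T3_zmem ha hb hc h1 j a).mpr haI) (hJ j hj)
  have hLTa : ∀ j : ℕ, 1 ≤ j → LV (T ^ (2 * j + 1) : Equiv.Perm ℝ) ((T ^ (-j : ℤ)) a) ((T ^ (j : ℤ)) a) := by
    intro j hj
    have e1 : LV (T ^ j : Equiv.Perm ℝ) ((T ^ (-j : ℤ)) a) a := by
      have := LV_pow ha hb hc h1 j ((T ^ (-j : ℤ)) a) (by
        intro i hi
        rw [← hT, hzz]
        exact hgoodA _ (by omega))
      simpa [← hT] using this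
    have e2 := LV_a ha hb hc h1
    rw [← hT] at e2
    have e3 : LV (T ^ (j - 1) : Equiv.Perm ℝ) (T a) ((T ^ (j : ℤ)) a) := by
      have := LV_pow ha hb hc h1 (j - 1) (T a) (by
        intro i hi
        have : T a = (T ^ (1:ℤ)) a := by simp
        rw [← hT, this, hzz]
        exact hgoodA _ (by omega))
      rw [← hT] at this
      convert this using 1
      rw [← Equiv.Perm.mul_apply, ← pow_succ]
      have : j - 1 + 1 = j := by omega
      rw [this]
      simp
    have e := e3.comp (e2.comp e1)
    have : (T ^ (2 * j + 1) : Equiv.Perm ℝ) = T ^ (j - 1) * (T ^ 2 * T ^ j) := by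
      rw [← pow_add, ← pow_add]
      congr 1
      omega
    rw [this]
    exact e
  set w := S a with hw
  have hwI : w ∈ unitI := hS.1.1 haI
  have hkey : ∀ j : ℕ, 1 ≤ j → J ≤ j →
      LV (T ^ (2 * j + 1) : Equiv.Perm ℝ) ((T ^ (-j : ℤ)) w) ((T ^ (j : ℤ)) w) := by
    intro j hj hJj
    have e1 := (hLSa j (by rw [abs_of_nonneg (by omega)]; omega)).comp (hLTa j hj)
    have e2 := hLSa (-j) (by rw [abs_neg, abs_of_nonneg (by omega)]; omega)
    have hh := hinv
    unfold LV at *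
    filter_upwards [e1, e2] with δ h1 h2
    rw [← h2, ← h1]
    have := hcomm ((2 * j + 1 : ℕ) : ℤ) ((T ^ (-j : ℤ)) a - δ)
    rw [zpow_natCast] at this
    exact this.symm
  by_cases hwa : ∃ i : ℤ, (T ^ i) a = w
  · obtain ⟨i, hi⟩ := hwa
    have hpow : ∀ m : ℕ, (P ^ m) a = (T ^ (i * m)) a := by
      intro m
      induction m with
      | zero => simp
      | succ m ih =>
        rw [pow_succ', Equiv.Perm.mul_apply, ih, hP, hcomm, ← hw, ← hi, hzz]
        congr 2
        push_cast
        ring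
    have := hpow n
    rw [hPT] at this
    have h2 : (1 : ℤ) = i * n := hcan a haI _ _ (by rw [zpow_one]; exact this)
    have h3 : (n : ℤ) ∣ 1 := ⟨i, by rw [h2]; ring⟩
    have := Int.le_of_dvd (by norm_num) h3
    omega
  by_cases hwb : ∃ i : ℤ, (T ^ i) (a + b) = w
  · obtain ⟨i, hi⟩ := hwb
    obtain ⟨j, hj⟩ : ∃ j : ℕ, 1 ≤ j ∧ J ≤ j ∧ i.natAbs + 1 ≤ j := ⟨J + i.natAbs + 1, by omega, by omega, by omega⟩
    have e := hkey j hj.1 hj.2.1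
    rw [← hi, hzz, hzz] at e
    obtain ⟨p, hp⟩ : ∃ p : ℕ, (p : ℤ) = j - i := ⟨(j - i : ℤ).toNat, by omega⟩
    obtain ⟨q, hq⟩ : ∃ q : ℕ, (q : ℤ) = j + i := ⟨(j + i : ℤ).toNat, by omega⟩
    have e1 : LV (T ^ p : Equiv.Perm ℝ) ((T ^ (-j + i : ℤ)) (a + b)) (a + b) := by
      have := LV_pow ha hb hc h1 p ((T ^ (-j + i : ℤ)) (a + b)) (by
        intro r hr
        rw [← hT, hzz]
        exact hgoodB _ (by omega) (by omega))
      rw [← hT] at this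
      convert this using 1
      rw [← zpow_natCast, hzz, hp]
      simp
    have e2 := LV_b ha hb hc h1
    rw [← hT] at e2
    have e3 : LV (T ^ q : Equiv.Perm ℝ) ((T ^ (2 : ℤ)) (a + b)) ((T ^ (j + i + 2 : ℤ)) (a + b)) := by
      have := LV_pow ha hb hc h1 q ((T ^ (2 : ℤ)) (a + b)) (by
        intro r hr
        rw [← hT, hzz]
        exact hgoodB _ (by omega) (by omega))
      rw [← hT] at this
      convert this using 1
      rw [← zpow_natCast, hzz, hq]
    have e4 := e3.comp (e2.comp e1)
    have h5 : (T ^ (2 * j + 1) : Equiv.Perm ℝ) = T ^ q * (T * T ^ p) := by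
      rw [← pow_succ', ← pow_add]
      congr 1
      omega
    rw [h5] at e
    have := hcan _ hbI _ _ (e.unique e4)
    omega
  · push Not at hwa hwb
    have e := hkey (J + 1) (by omega) (by omega)
    have hne : ∀ x, (∀ i : ℤ, (T ^ i) x ≠ w) → ∀ i : ℤ, (T ^ i) w ≠ x :=
      fun x h i h' => h _ (hinv _ _ _ h')
    have hwa' := hne a hwa
    have hwb' := hne _ hwb
    have e1 := LV_pow ha hb hc h1 (2 * (J + 1) + 1) ((T ^ (-((J + 1 : ℕ) : ℤ))) w) (by
        intro r hr
        rw [← hT, hzz]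
        apply hgood _ ((T3_zmem ha hb hc h1 _ _).mpr hwI) (hwa' _) (hwb' _)
        rw [hzz]
        exact hwb' _)
    rw [← hT] at e1
    have := e.unique e1
    rw [← zpow_natCast, hzz] at this
    have := hcan _ hwI _ _ this
    push_cast at this
    omega

end forward

/-! ### Roots when the IDOC fails -/

section backward
open Filter Topology

/-- An integer-valued step function whose coboundary along the rotation is explicit. -/
theorem exists_N (α L : ℝ) (hL : 0 < L) (k : ℤ) : ∃ N : ℝ → ℤ,
    (∀ x, N (x + α) - N x = ⌊(x + k * α) / L⌋ - ⌊x / L⌋) ∧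
    (∀ x, N (x + L) = N x + k) ∧
    (∀ x, ∀ᶠ δ in 𝓝[>] (0:ℝ), N (x + δ) = N x) ∧
    (∀ x, ∃ v, ∀ᶠ δ in 𝓝[>] (0:ℝ), N (x - δ) = v) ∧
    (∃ B : ℤ, ∀ x ∈ unitI, |N x| ≤ B) := by
  have hshift : ∀ e x : ℝ, ⌊(x + L + e) / L⌋ = ⌊(x + e) / L⌋ + 1 := by
    intro e x
    rw [← Int.floor_add_one]
    congr 1
    field_simp
    ring
  have hright : ∀ e x : ℝ, ∀ᶠ δ in 𝓝[>] (0:ℝ), ⌊(x + δ + e) / L⌋ = ⌊(x + e) / L⌋ := by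
    intro e x
    have hlt := Int.lt_floor_add_one ((x + e) / L)
    have hle := Int.floor_le ((x + e) / L)
    rw [div_lt_iff₀ hL] at hlt
    rw [le_div_iff₀ hL] at hle
    filter_upwards [small (sub_pos.mpr hlt)] with δ hδ
    rw [Int.floor_eq_iff, le_div_iff₀ hL, div_lt_iff₀ hL]
    constructor <;> linarith
  have hleft : ∀ e x : ℝ, ∀ᶠ δ in 𝓝[>] (0:ℝ), ⌊(x - δ + e) / L⌋ = ⌈(x + e) / L⌉ - 1 := by
    intro e x
    have hlt := Int.ceil_lt_add_one ((x + e) / L)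
    have hle := Int.le_ceil ((x + e) / L)
    rw [div_le_iff₀ hL] at hle
    rw [← sub_lt_iff_lt_add, lt_div_iff₀ hL] at hlt
    filter_upwards [small (sub_pos.mpr hlt)] with δ hδ
    rw [Int.floor_eq_iff, le_div_iff₀ hL, div_lt_iff₀ hL]
    push_cast
    constructor <;> linarith
  have hbd : ∀ e : ℝ, ∃ B : ℤ, ∀ x ∈ unitI, |⌊(x + e) / L⌋| ≤ B := by
    intro e
    refine ⟨max |⌊(0 + e) / L⌋| |⌊(1 + e) / L⌋|, fun x hx => ?_⟩
    have h0 : ⌊(0 + e) / L⌋ ≤ ⌊(x + e) / L⌋ :=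
      Int.floor_mono (by gcongr; exact hx.1)
    have h1 : ⌊(x + e) / L⌋ ≤ ⌊(1 + e) / L⌋ :=
      Int.floor_mono (by gcongr; exact hx.2.le)
    exact abs_le_max_abs_abs h0 h1
  induction k using Int.induction_on with
  | zero => exact ⟨fun _ => 0, by simp, by simp, by simp, by intro x; exact ⟨0, by simp⟩, 0, by simp⟩
  | succ i ih =>
    obtain ⟨N, h1, h2, h3, h4, B, h5⟩ := ih
    refine ⟨fun x => N x + ⌊(x + i * α) / L⌋, ?_, ?_, ?_, ?_, ?_⟩
    · intro x
      have := h1 x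
      have e : x + α + i * α = x + (i + 1) * α := by ring
      push_cast at *
      rw [e]
      linarith
    · intro x
      simp only [h2, hshift]
      ring
    · intro x
      filter_upwards [h3 x, hright (i * α) x] with δ e1 e2
      rw [e1, e2]
    · intro x
      obtain ⟨v, hv⟩ := h4 x
      refine ⟨v + (⌈(x + i * α) / L⌉ - 1), ?_⟩
      filter_upwards [hv, hleft (i * α) x] with δ e1 e2
      rw [e1, e2]
    · obtain ⟨B', hB'⟩ := hbd (i * α)
      exact ⟨B + B', fun x hx => (abs_add_le _ _).trans (add_le_add (h5 x hx) (hB' x hx))⟩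
  | pred i ih =>
    obtain ⟨N, h1, h2, h3, h4, B, h5⟩ := ih
    refine ⟨fun x => N x - ⌊(x + (-i - 1) * α) / L⌋, ?_, ?_, ?_, ?_, ?_⟩
    · intro x
      have := h1 x
      have e : x + α + (-i - 1) * α = x + -i * α := by ring
      push_cast at *
      rw [e]
      linarith
    · intro x
      simp only [h2, hshift]
      ring
    · intro x
      filter_upwards [h3 x, hright ((-i - 1) * α) x] with δ e1 e2
      rw [e1, e2]
    · intro x
      obtain ⟨v, hv⟩ := h4 x
      refine ⟨v - (⌈(x + (-i - 1) * α) / L⌉ - 1), ?_⟩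
      filter_upwards [hv, hleft ((-i - 1) * α) x] with δ e1 e2
      rw [e1, e2]
    · obtain ⟨B', hB'⟩ := hbd ((-i - 1) * α)
      exact ⟨B + B', fun x hx => (abs_sub _ _).trans (add_le_add (h5 x hx) (hB' x hx))⟩

/-- Local translations from both sides give a finite partition. -/
theorem exists_partition (f : ℝ → ℝ)
    (hR : ∀ x ∈ unitI, ∀ᶠ δ in 𝓝[>] (0:ℝ), f (x + δ) = f x + δ)
    (hLf : ∀ x : ℝ, 0 < x → x ≤ 1 → ∃ y, LV f x y) :
    ∃ (k : ℕ) (β : Fin (k + 1) → ℝ), StrictMono β ∧ β 0 = 0 ∧ β (Fin.last k) = 1 ∧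
    ∀ i : Fin k, ∃ c : ℝ, ∀ x ∈ Set.Ico (β i.castSucc) (β i.succ), f x = x + c := by
  let Q : ℝ → Prop := fun t => ∃ (k : ℕ) (β : Fin (k + 1) → ℝ), StrictMono β ∧ β 0 = 0 ∧
    β (Fin.last k) = t ∧
    ∀ i : Fin k, ∃ c : ℝ, ∀ x ∈ Set.Ico (β i.castSucc) (β i.succ), f x = x + c
  change Q 1
  have hQ0 : Q 0 := ⟨0, fun _ => 0, fun i j h => absurd h (by omega), rfl, rfl, fun i => i.elim0⟩
  have happ : ∀ t t' : ℝ, Q t → t < t' → (∃ c, ∀ x ∈ Set.Ico t t', f x = x + c) → Q t' := by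
    rintro t t' ⟨k, β, hm, h0, hl, hp⟩ htt' hc
    refine ⟨k + 1, Fin.snoc (α := fun _ => ℝ) β t', ?_, ?_, ?_, ?_⟩
    · rw [Fin.strictMono_iff_lt_succ]
      intro i
      refine Fin.lastCases ?_ (fun i => ?_) i
      · simp [hl, htt', -Fin.natCast_eq_last, Fin.succ_last]
      · rw [Fin.succ_castSucc, Fin.snoc_castSucc, Fin.snoc_castSucc]
        exact hm Fin.castSucc_lt_succ
    · have : (0 : Fin (k + 1 + 1)) = Fin.castSucc 0 := rfl
      rw [this, Fin.snoc_castSucc, h0]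
    · rw [Fin.snoc_last]
    · intro i
      refine Fin.lastCases ?_ (fun i => ?_) i
      · rw [Fin.succ_last, Fin.snoc_last, Fin.snoc_castSucc, hl]
        exact hc
      · rw [Fin.succ_castSucc, Fin.snoc_castSucc, Fin.snoc_castSucc]
        exact hp i
  set B : Set ℝ := {t | Q t ∧ t ∈ Set.Icc (0:ℝ) 1} with hB
  have h0B : (0:ℝ) ∈ B := ⟨hQ0, by norm_num⟩
  have hbdd : BddAbove B := ⟨1, fun t ht => ht.2.2⟩
  have hs0 : 0 ≤ sSup B := le_csSup hbdd h0B
  have hs1 : sSup B ≤ 1 := csSup_le ⟨0, h0B⟩ (fun t ht => ht.2.2)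
  set s := sSup B with hs
  have hsQ : Q s := by
    rcases hs0.eq_or_lt with h | h
    · rw [← h]; exact hQ0
    · obtain ⟨y, hy⟩ := hLf s h hs1
      unfold LV at hy
      rw [eventually_nhdsWithin_iff, Metric.eventually_nhds_iff] at hy
      obtain ⟨ε, hε, hy⟩ := hy
      obtain ⟨t, htB, ht⟩ := exists_lt_of_lt_csSup ⟨0, h0B⟩ (show s - ε < sSup B by linarith)
      rcases (le_csSup hbdd htB).eq_or_lt with e | e
      · rw [hs, ← e]; exact htB.1
      · refine happ t s htB.1 e ⟨y - s, fun x hx => ?_⟩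
        have := @hy (s - x) (by
          rw [Real.dist_eq, sub_zero, abs_of_pos (by linarith [hx.2])]
          linarith [hx.1]) (by simpa using hx.2)
        rw [show s - (s - x) = x by ring] at this
        rw [this]; ring
  rcases hs1.eq_or_lt with h | h
  · rw [← h]; exact hsQ
  · exfalso
    have hy := hR s ⟨hs0, h⟩
    rw [eventually_nhdsWithin_iff, Metric.eventually_nhds_iff] at hy
    obtain ⟨ε, hε, hy⟩ := hy
    obtain ⟨η, hη0, hηε, hη1⟩ : ∃ η, 0 < η ∧ η ≤ ε ∧ η ≤ 1 - s :=
      ⟨min ε (1 - s), lt_min hε (by linarith), min_le_left _ _, min_le_right _ _⟩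
    have : s + η ∈ B := by
      refine ⟨happ s (s + η) hsQ (by linarith) ⟨f s - s, fun x hx => ?_⟩, by linarith, by linarith⟩
      rcases hx.1.eq_or_lt with e | e
      · rw [← e]; ring
      · have := @hy (x - s) (by
          rw [Real.dist_eq, sub_zero, abs_of_pos (by linarith)]
          linarith [hx.2]) (by simpa using e)
        rw [show s + (x - s) = x by ring] at this
        rw [this]; ring
    have := le_csSup hbdd this
    linarith

variable {a b c : ℝ} (ha : 0 < a) (hb : 0 < b) (hc : 0 < c) (h1 : a + b + c = 1)

/-- Displacements along an orbit lie in the group generated by `b + c` and `1 + b`. -/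
theorem displacement {x : ℝ} (hx : x ∈ unitI) (m : ℤ) :
    ∃ u v : ℤ, (T3 a b c ha hb hc h1 ^ m) x = x + u * (b + c) - v * (1 + b) := by
  have step : ∀ y ∈ unitI, ∃ u v : ℤ, T3 a b c ha hb hc h1 y = y + u * (b + c) - v * (1 + b) := by
    intro y hy
    rcases T3_cases ha hb hc h1 hy with ⟨-, h⟩ | ⟨-, -, h⟩ | ⟨-, h⟩
    · exact ⟨1, 0, by rw [h]; push_cast; ring⟩
    · exact ⟨2, 1, by rw [h]; push_cast; linarith⟩
    · exact ⟨1, 1, by rw [h]; push_cast; linarith⟩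
  induction m using Int.induction_on with
  | zero => exact ⟨0, 0, by simp⟩
  | succ i ih =>
    obtain ⟨u, v, h⟩ := ih
    obtain ⟨u', v', h'⟩ := step _ ((T3_zmem ha hb hc h1 i x).mpr hx)
    refine ⟨u + u', v + v', ?_⟩
    rw [add_comm, zpow_add, zpow_one, Equiv.Perm.mul_apply, h', h]
    push_cast; ring
  | pred i ih =>
    obtain ⟨u, v, h⟩ := ih
    obtain ⟨u', v', h'⟩ := step _ ((T3_zmem ha hb hc h1 (-i - 1) x).mpr hx)
    refine ⟨u - u', v - v', ?_⟩
    have e : T3 a b c ha hb hc h1 ((T3 a b c ha hb hc h1 ^ (-(i:ℤ) - 1)) x)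
        = (T3 a b c ha hb hc h1 ^ (-(i:ℤ))) x := by
      rw [← Equiv.Perm.mul_apply]
      congr 1
      rw [← zpow_one_add]
      congr 1
      ring
    rw [e, h] at h'
    push_cast
    linarith

/-- Points of the rotation orbit lying in the unit interval are on the same orbit. -/
theorem rot_orbit_nat (u : ℕ) : ∀ x ∈ unitI, ∀ z : ℝ, 0 ≤ z → z < 1 + b →
    (∃ v : ℤ, z = x + u * (b + c) + v * (1 + b)) →
    (∃ m : ℤ, z = (T3 a b c ha hb hc h1 ^ m) x) ∨
    (∃ m : ℤ, a ≤ (T3 a b c ha hb hc h1 ^ m) x ∧ (T3 a b c ha hb hc h1 ^ m) x < a + b ∧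
      z = (T3 a b c ha hb hc h1 ^ m) x + (b + c)) := by
  have hsucc : ∀ (m : ℤ) (x : ℝ), (T3 a b c ha hb hc h1 ^ (1 + m)) x
      = T3 a b c ha hb hc h1 ((T3 a b c ha hb hc h1 ^ m) x) := by
    intro m x; rw [zpow_add, zpow_one, Equiv.Perm.mul_apply]
  induction u with
  | zero =>
    rintro x hx z hz0 hz1 ⟨v, hv⟩
    left
    refine ⟨0, ?_⟩
    have hv0 : v = 0 := by
      have h0 := hx.1
      have h01 := hx.2
      simp only [Nat.cast_zero, zero_mul, add_zero] at hv
      have e1 : (v : ℝ) < 1 := by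
        by_contra h
        have : 1 * (1 + b) ≤ v * (1 + b) := mul_le_mul_of_nonneg_right (not_lt.mp h) (by linarith)
        linarith
      have e2 : (-1 : ℝ) < v := by
        by_contra h
        have : v * (1 + b) ≤ (-1) * (1 + b) := mul_le_mul_of_nonneg_right (not_lt.mp h) (by linarith)
        linarith
      have e1' : v < 1 := by exact_mod_cast e1
      have e2' : -1 < v := by exact_mod_cast e2
      omega
    simp [hv, hv0]
  | succ u ih =>
    rintro x hx z hz0 hz1 ⟨v, hv⟩
    obtain ⟨z', hz'0, hz'1, hzz', v', hv'⟩ : ∃ z', 0 ≤ z' ∧ z' < 1 + b ∧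
        (z = z' + (b + c) ∨ z = z' + (b + c) - (1 + b)) ∧
        ∃ v' : ℤ, z' = x + u * (b + c) + v' * (1 + b) := by
      by_cases h : b + c ≤ z
      · exact ⟨z - (b + c), by linarith, by linarith, Or.inl (by ring), v, by
          rw [hv]; push_cast; ring⟩
      · exact ⟨z - (b + c) + (1 + b), by linarith, by linarith, Or.inr (by ring), v + 1, by
          rw [hv]; push_cast; ring⟩
    rcases ih x hx z' hz'0 hz'1 ⟨v', hv'⟩ with ⟨m, hm⟩ | ⟨m, hm1, hm2, hm3⟩
    · have hI := (T3_zmem ha hb hc h1 m x).mpr hx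
      rcases T3_cases ha hb hc h1 hI with ⟨hlt, h⟩ | ⟨hge, hlt, h⟩ | ⟨hge, h⟩
      · left
        refine ⟨1 + m, ?_⟩
        rw [hsucc, h, ← hm]
        rw [← hm] at hlt
        rcases hzz' with h | h <;> linarith
      · right
        refine ⟨m, hge, hlt, ?_⟩
        rw [← hm] at hlt ⊢
        rcases hzz' with h | h <;> linarith
      · left
        refine ⟨1 + m, ?_⟩
        rw [hsucc, h, ← hm]
        rw [← hm] at hge
        rcases hzz' with h | h <;> linarith
    · left
      refine ⟨1 + m, ?_⟩
      have hI := (T3_zmem ha hb hc h1 m x).mpr hx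
      rw [hsucc]
      rcases T3_cases ha hb hc h1 hI with ⟨hlt, h⟩ | ⟨hge, hlt, h⟩ | ⟨hge, h⟩
      · linarith
      · rw [h]
        rcases hzz' with h | h <;> linarith
      · linarith

theorem rot_orbit {x x' : ℝ} (hx : x ∈ unitI) (hx' : x' ∈ unitI) (u v : ℤ)
    (h : x = x' + u * (b + c) + v * (1 + b)) : ∃ m : ℤ, x = (T3 a b c ha hb hc h1 ^ m) x' := by
  have main : ∀ (u : ℕ) (v : ℤ) (x x' : ℝ), x ∈ unitI → x' ∈ unitI →
      x = x' + u * (b + c) + v * (1 + b) → ∃ m : ℤ, x = (T3 a b c ha hb hc h1 ^ m) x' := by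
    intro u v x x' hx hx' h
    rcases rot_orbit_nat ha hb hc h1 u x' hx' x hx.1 (by linarith [hx.2]) ⟨v, h⟩ with h | ⟨m, h, h', h''⟩
    · exact h
    · have := hx.2
      linarith
  obtain ⟨n, rfl | rfl⟩ := u.eq_nat_or_neg
  · exact main n v x x' hx hx' (by simpa using h)
  · obtain ⟨m, hm⟩ := main n (-v) x' x hx' hx (by push_cast at *; linarith)
    exact ⟨-m, by rw [hm]; simp⟩

theorem backward_aux
    (hap : ∀ x ∈ unitI, ∀ m : ℤ, (T3 a b c ha hb hc h1 ^ m) x = x → m = 0)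
    (k n : ℤ) (hk : b = k * (b + c) - n * (1 + b)) :
    ∃ (S : ℝ → ℝ) (r : ℕ), IsIET S ∧ 2 ≤ r ∧ S^[r] = T3 a b c ha hb hc h1 := by
  set T := T3 a b c ha hb hc h1 with hT
  set α := b + c with hα
  set L := 1 + b with hLdef
  clear_value α L
  have hL : 0 < L := by linarith
  obtain ⟨N, hN1, hN2, hN3, hN4, B, hN5⟩ := exists_N α L hL k
  -- the increments of N along T
  set M : ℤ := n + 1 with hM
  clear_value M
  have hone : (1:ℝ) = M * L - k * α := by rw [hM]; push_cast; linarith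
  have hstepN : ∀ x, 0 ≤ x → x < L → N (x + α) = N x + n + (if x < 1 then 0 else 1) := by
    intro x h0 hxL
    have e := hN1 x
    have e0 : ⌊x / L⌋ = 0 := by
      rw [Int.floor_eq_iff, le_div_iff₀ hL, div_lt_iff₀ hL]
      push_cast; constructor <;> linarith
    have e1 : ⌊(x + k * α) / L⌋ = n + (if x < 1 then 0 else 1) := by
      rw [Int.floor_eq_iff, le_div_iff₀ hL, div_lt_iff₀ hL]
      split_ifs <;> push_cast <;> constructor <;> linarith
    rw [e0, e1] at e
    linarith
  have hTN : ∀ x ∈ unitI, ∃ u v : ℤ, T x = x + u * α - v * L ∧ N (T x) + 1 = N x + (M * u - k * v) := by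
    intro x hx
    have hx0 := hx.1
    have hx1 := hx.2
    have hsub : ∀ y, N (y - L) = N y - k := by
      intro y
      have := hN2 (y - L)
      rw [sub_add_cancel] at this
      omega
    have s1 := hstepN x hx0 (by linarith)
    rw [if_pos hx1] at s1
    rcases T3_cases ha hb hc h1 hx with ⟨hlt, h⟩ | ⟨hge, hlt, h⟩ | ⟨hge, h⟩
    · refine ⟨1, 0, by rw [h, hα]; push_cast; ring, ?_⟩
      rw [h, ← hα, s1, hM]; ring
    · refine ⟨2, 1, by rw [h]; push_cast; linarith, ?_⟩
      have s2 := hstepN (x + α) (by linarith) (by linarith)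
      rw [if_neg (by linarith)] at s2
      have : x + (c - a) = x + α + α - L := by linarith
      rw [h, this, hsub, s2, s1, hM]; ring
    · refine ⟨1, 1, by rw [h]; push_cast; linarith, ?_⟩
      have : x - (a + b) = x + α - L := by linarith
      rw [h, this, hsub, s1, hM]; ring
  -- gcd data
  have hgcd : M.gcd k ≠ 0 := by
    intro h
    rw [Int.gcd_eq_zero_iff] at h
    rw [h.1, h.2] at hone
    norm_num at hone
  obtain ⟨d, hd⟩ : ∃ d : ℕ, d = M.gcd k := ⟨_, rfl⟩
  have hd0 : 0 < d := by omega
  have hdR : (0:ℝ) < d := by exact_mod_cast hd0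
  obtain ⟨M', hM'⟩ : (d : ℤ) ∣ M := by rw [hd]; exact Int.gcd_dvd_left ..
  obtain ⟨k', hk'⟩ : (d : ℤ) ∣ k := by rw [hd]; exact Int.gcd_dvd_right ..
  obtain ⟨p, q, hpq⟩ : ∃ p q : ℤ, M' * p + k' * q = 1 := by
    refine ⟨M.gcdA k, M.gcdB k, ?_⟩
    have := Int.gcd_eq_gcd_ab M k
    rw [← hd] at this
    have hd0' : (d : ℤ) ≠ 0 := by omega
    apply mul_left_cancel₀ hd0'
    rw [mul_one]
    conv_rhs => rw [this]
    conv_rhs => enter [1, 1]; rw [hM']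
    conv_rhs => enter [2, 1]; rw [hk']
    ring
  have hpqR : (M' : ℝ) * p + k' * q = 1 := by exact_mod_cast hpq
  have hMR : (M : ℝ) = d * M' := by rw [hM']; push_cast; ring
  have hkR : (k : ℝ) = d * k' := by rw [hk']; push_cast; ring
  have hone' : (1:ℝ) = d * (M' * L - k' * α) := by
    rw [hone, hMR, hkR]; ring
  set e := p * α + q * L with he
  clear_value e
  have hαe : d * α = d * (M' * e) - q := by
    linear_combination (-(d:ℝ) * α) * hpqR + q * hone' - d * M' * he
  have hLe : d * L = d * (k' * e) + p := by
    linear_combination (-(d:ℝ) * L) * hpqR - p * hone' - d * k' * he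
  -- the relation
  let E : ℝ → ℝ → ℤ → Prop := fun x y i => (d : ℤ) ∣ N x - i ∧ ∃ t : ℤ, d * x - e * N x = y + t
  have hET : ∀ x ∈ unitI, ∀ y i, E (T x) (y + e) (i - 1) ↔ E x y i := by
    intro x hx y i
    obtain ⟨u, v, h1, h2⟩ := hTN x hx
    have h2R : (N (T x) : ℝ) + 1 = N x + (M * u - k * v) := by exact_mod_cast h2
    have hdvd : (d : ℤ) ∣ M * u - k * v := ⟨M' * u - k' * v, by rw [hM', hk']; ring⟩
    have key : d * T x - e * N (T x) = d * x - e * N x + e - (q * u + p * v : ℤ) := by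
      have : (N (T x) : ℝ) = N x + (d * M' * u - d * k' * v) - 1 := by
        rw [hMR, hkR] at h2R; linarith
      rw [this, h1]
      push_cast
      linear_combination (u : ℝ) * hαe - v * hLe
    constructor
    · rintro ⟨hA, t, ht⟩
      refine ⟨?_, t + (q * u + p * v), ?_⟩
      · have := dvd_sub hA hdvd
        rw [show N x - i = N (T x) - (i - 1) - (M * u - k * v) by linarith]
        exact this
      · rw [key] at ht
        push_cast at *
        linarith
    · rintro ⟨hA, t, ht⟩
      refine ⟨?_, t - (q * u + p * v), ?_⟩
      · have := dvd_add hA hdvd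
        rw [show N (T x) - (i - 1) = N x - i + (M * u - k * v) by linarith]
        exact this
      · rw [key]
        push_cast at *
        linarith
  have hETz : ∀ (m : ℤ), ∀ x ∈ unitI, ∀ y i, E ((T ^ m) x) (y + m * e) (i - m) ↔ E x y i := by
    intro m x hx
    induction m using Int.induction_on with
    | zero => intro y i; simp
    | succ j ih =>
      intro y i
      rw [← ih, ← hET _ ((T3_zmem ha hb hc h1 j x).mpr hx), ← hT]
      rw [add_comm, zpow_add, zpow_one, Equiv.Perm.mul_apply]
      apply iff_of_eq
      congr 1
      · push_cast; ring
      · ring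
    | pred j ih =>
      intro y i
      rw [← ih, ← hET _ ((T3_zmem ha hb hc h1 (-j - 1) x).mpr hx), ← hT]
      have e1 : T ((T ^ (-(j:ℤ) - 1)) x) = (T ^ (-(j:ℤ))) x := by
        rw [← Equiv.Perm.mul_apply]
        congr 1
        rw [← zpow_one_add]
        congr 1
        ring
      rw [e1]
      apply iff_of_eq
      congr 1
      · push_cast; ring
      · ring
  have hE_self : ∀ x, E x (d * x - e * N x) (N x) := by
    intro x
    exact ⟨by simp, 0, by simp⟩
  -- existence
  have hex : ∀ (y : ℝ) (i : ℤ), ∃ x ∈ unitI, E x y i := by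
    intro y i
    obtain ⟨x0, hx0, u, v, huv⟩ : ∃ x0 ∈ unitI, ∃ u v : ℤ,
        x0 = (y + i * e) / d + u * α - v * L := by
      set w := (y + i * e) / d
      have hf := Int.floor_le (w / L)
      have hf' := Int.lt_floor_add_one (w / L)
      rw [le_div_iff₀ hL] at hf
      rw [div_lt_iff₀ hL] at hf'
      by_cases h : w - ⌊w / L⌋ * L < 1
      · exact ⟨w - ⌊w / L⌋ * L, ⟨by linarith, h⟩, 0, ⌊w / L⌋, by push_cast; ring⟩
      · exact ⟨w - ⌊w / L⌋ * L + α - L, ⟨by linarith, by linarith⟩, 1, ⌊w / L⌋ + 1, by push_cast; ring⟩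
    set s : ℤ := M' * u - k' * v with hs
    set m : ℤ := i + d * s - N x0 with hm
    refine ⟨(T ^ (-m)) x0, (T3_zmem ha hb hc h1 _ _).mpr hx0, ?_⟩
    have : E x0 (y + m * e) (i - m) := by
      refine ⟨⟨s, by rw [hm]; ring⟩, -(q * u) - p * v, ?_⟩
      have hdw : d * ((y + i * e) / d) = y + i * e := by field_simp
      have hmR : (m : ℝ) = i + d * (M' * u - k' * v) - N x0 := by rw [hm, hs]; push_cast; ring
      rw [hmR]
      push_cast
      linear_combination (d:ℝ) * huv + hdw + u * hαe - v * hLe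
    rw [← hETz (-m) x0 hx0] at this
    convert this using 1
    · push_cast; ring
    · ring
  -- uniqueness
  have huniq : ∀ x ∈ unitI, ∀ x' ∈ unitI, ∀ y i, E x y i → E x' y i → x = x' := by
    intro x hx x' hx' y i hE hE'
    obtain ⟨⟨s1, hs1⟩, t1, ht1⟩ := id hE
    obtain ⟨⟨s2, hs2⟩, t2, ht2⟩ := id hE'
    have hNN : (N x : ℝ) = N x' + d * (s1 - s2) := by
      have : N x = N x' + d * (s1 - s2) := by linarith
      exact_mod_cast this
    obtain ⟨m, hm⟩ := rot_orbit ha hb hc h1 hx hx' ((s1 - s2) * p - (t1 - t2) * k')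
      ((s1 - s2) * q + (t1 - t2) * M') (by
        apply mul_left_cancel₀ hdR.ne'
        rw [hNN] at ht1
        rw [← hα, ← hLdef]
        push_cast
        linear_combination ht1 - ht2 + ((s1 : ℝ) - s2) * d * he + ((t1:ℝ) - t2) * hone')
    rw [← hT] at hm
    by_cases hm0 : m = 0
    · rw [hm, hm0]; simp
    exfalso
    -- e is rational
    have e1 := (hETz m x' hx' y i).mpr hE'
    rw [← hm] at e1
    obtain ⟨-, t3, ht3⟩ := e1
    have hme : m * e = (t1 - t3 : ℤ) := by push_cast; linarith
    have hαr : (m * d) * α = (d * M' * (t1 - t3) - q * m : ℤ) := by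
      push_cast at *
      linear_combination (m:ℝ) * hαe + d * M' * hme
    have hLr : (m * d) * L = (d * k' * (t1 - t3) + p * m : ℤ) := by
      push_cast at *
      linear_combination (m:ℝ) * hLe + d * k' * hme
    set D : ℤ := m * d with hD
    have hD0 : D ≠ 0 := by
      rw [hD]
      exact mul_ne_zero hm0 (by omega)
    have h0I : (0:ℝ) ∈ unitI := ⟨le_refl _, by norm_num⟩
    have hzex : ∀ j : ℤ, ∃ z : ℤ, D * (T ^ j) 0 = z := by
      intro j
      obtain ⟨u, v, huv⟩ := displacement ha hb hc h1 h0I j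
      refine ⟨u * (d * M' * (t1 - t3) - q * m) - v * (d * k' * (t1 - t3) + p * m), ?_⟩
      rw [← hT, ← hα, ← hLdef] at huv
      rw [huv]
      push_cast at *
      rw [hD]
      push_cast
      linear_combination (u:ℝ) * hαr - v * hLr
    choose z hz using hzex
    have hzb : ∀ j, z j ∈ Set.Icc (-|D|) |D| := by
      intro j
      have hI := (T3_zmem ha hb hc h1 j 0).mpr h0I
      rw [← hT] at hI
      have : |(z j : ℝ)| ≤ |(D : ℝ)| := by
        rw [← hz, abs_mul]
        apply mul_le_of_le_one_right (abs_nonneg _)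
        rw [abs_le]
        exact ⟨by linarith [hI.1], hI.2.le⟩
      rw [Set.mem_Icc, ← abs_le]
      exact_mod_cast this
    obtain ⟨j, j', hne, hjj'⟩ : ∃ j j', j ≠ j' ∧ z j = z j' := by
      by_contra hcon
      push Not at hcon
      have hinj : Function.Injective z := fun j j' h => by
        by_contra hne
        exact hcon j j' hne h
      exact Set.infinite_of_injective_forall_mem hinj hzb (Set.finite_Icc _ _)
    have hTj : (T ^ j) 0 = (T ^ j') 0 := by
      have : (D : ℝ) ≠ 0 := by exact_mod_cast hD0
      apply mul_left_cancel₀ this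
      rw [hz, hz, hjj']
    have : (T ^ (j - j')) 0 = 0 := by
      rw [sub_eq_neg_add, zpow_add, Equiv.Perm.mul_apply, hTj]
      simp
    have := hap 0 h0I _ this
    omega
  -- the root
  have hdd : ((d:ℝ) + 1) ≠ 0 := by positivity
  set ε := e / (d + 1) with hε
  classical
  choose G hGI hGE using hex
  let S : ℝ → ℝ := fun x => if x ∈ unitI then G (d * x - e * N x + ε) (N x - 1) else x
  have hSin : ∀ x, x ∈ unitI → S x ∈ unitI := by
    intro x hx
    simp only [S, if_pos hx]
    exact hGI _ _
  have hSout : ∀ x, x ∉ unitI → S x = x := by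
    intro x hx
    simp only [S, if_neg hx]
  have hSE : ∀ x ∈ unitI, E (S x) (d * x - e * N x + ε) (N x - 1) := by
    intro x hx
    simp only [S, if_pos hx]
    exact hGE _ _
  have hSE' : ∀ x ∈ unitI, ∀ y i, E x y i → E (S x) (y + ε) (i - 1) := by
    intro x hx y i hE
    obtain ⟨hA, t, ht⟩ := hSE x hx
    obtain ⟨hA', t', ht'⟩ := hE
    refine ⟨?_, t + t', ?_⟩
    · have := dvd_add hA hA'
      rw [show N (S x) - (i - 1) = N (S x) - (N x - 1) + (N x - i) by ring]
      exact this
    · push_cast; linarith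
  have hSit : ∀ (j : ℕ), ∀ x ∈ unitI, S^[j] x ∈ unitI ∧
      E (S^[j] x) (d * x - e * N x + j * ε) (N x - j) := by
    intro j x hx
    induction j with
    | zero => simpa using ⟨hx, hE_self x⟩
    | succ j ih =>
      rw [Function.iterate_succ_apply']
      refine ⟨hSin _ ih.1, ?_⟩
      have := hSE' _ ih.1 _ _ ih.2
      convert this using 1
      · push_cast; ring
      · push_cast; ring
  have hroot : S^[d + 1] = T := by
    funext x
    by_cases hx : x ∈ unitI
    · have h2 := hSit (d + 1) x hx
      have h3 := (hET x hx _ _).mpr (hE_self x)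
      refine huniq _ h2.1 _ ((T3_mem ha hb hc h1 x).mpr hx) _ _ h2.2 ?_
      obtain ⟨⟨s, hs⟩, t, ht⟩ := h3
      refine ⟨⟨s + 1, ?_⟩, t, ?_⟩
      · rw [mul_add, ← hs]; push_cast; ring
      · rw [ht, hε]
        push_cast
        field_simp
    · rw [Function.iterate_fixed (hSout x hx)]
      exact (T3_not_mem ha hb hc h1 hx).symm
  refine ⟨S, d + 1, ⟨?_, hSout, ?_⟩, by omega, hroot⟩
  · have hbij : Function.Bijective S^[d + 1] := by rw [hroot]; exact T.bijective
    have hinj : Function.Injective S := by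
      have := hbij.1
      rw [Function.iterate_succ] at this
      exact this.of_comp
    have hsurj : Function.Surjective S := by
      have := hbij.2
      rw [Function.iterate_succ'] at this
      exact this.of_comp
    refine ⟨hSin, hinj.injOn, ?_⟩
    intro y hy
    obtain ⟨x, rfl⟩ := hsurj y
    refine ⟨x, ?_, rfl⟩
    by_contra hx
    rw [hSout x hx] at hy
    exact hx hy
  · apply exists_partition
    · intro x hx
      have hSx := hSin x hx
      filter_upwards [hN3 x, hN3 (S x), small (sub_pos.mpr hx.2), small (sub_pos.mpr hSx.2)]
        with δ e1 e2 e3 e4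
      have hxδ : x + δ ∈ unitI := ⟨by linarith [hx.1], by linarith⟩
      have hSxδ : S x + δ ∈ unitI := ⟨by linarith [hSx.1], by linarith⟩
      refine huniq _ (hSin _ hxδ) _ hSxδ _ _ (hSE _ hxδ) ?_
      obtain ⟨hA, t, ht⟩ := hSE x hx
      refine ⟨by rw [e1, e2]; exact hA, t, ?_⟩
      rw [e1, e2]
      linarith
    · intro x hx0 hx1
      -- finitely many displacements
      obtain ⟨C, hC, hCmem⟩ : ∃ C : Set ℝ, C.Finite ∧ ∀ x ∈ unitI, S x - x ∈ C := by
        obtain ⟨K, hK⟩ : ∃ K : ℤ, d + |e| * (2 * B) + |ε| ≤ K := ⟨_, Int.le_ceil _⟩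
        refine ⟨(fun w : ℤ × ℤ => (e * w.1 + ε + w.2) / d) '' (Set.Icc (-(2 * B)) (2 * B) ×ˢ Set.Icc (-K) K),
          ((Set.finite_Icc _ _).prod (Set.finite_Icc _ _)).image _, ?_⟩
        intro x hx
        obtain ⟨hA, t, ht⟩ := hSE x hx
        have hb1 := hN5 x hx
        have hb2 := hN5 _ (hSin x hx)
        have hdiff : |N (S x) - N x| ≤ 2 * B := (abs_sub _ _).trans (by linarith)
        refine ⟨(N (S x) - N x, t), ⟨abs_le.mp hdiff, ?_⟩, ?_⟩
        · rw [Set.mem_Icc, ← abs_le]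
          have hteq : (t : ℝ) = d * (S x - x) - e * ((N (S x) - N x : ℤ) : ℝ) - ε := by
            push_cast; linarith
          have hdR' : |((N (S x) - N x : ℤ) : ℝ)| ≤ 2 * B := by exact_mod_cast hdiff
          have h3 : |S x - x| ≤ 1 := by
            have := (hSin x hx).1
            have := (hSin x hx).2
            have := hx.1
            have := hx.2
            rw [abs_le]; constructor <;> linarith
          have : |(t : ℝ)| ≤ K := by
            rw [hteq]
            refine le_trans (abs_sub _ _) (le_trans (add_le_add_left (abs_sub _ _) _) ?_)
            rw [abs_mul, abs_mul, abs_of_pos hdR]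
            have := mul_le_mul_of_nonneg_left h3 hdR.le
            have := mul_le_mul_of_nonneg_left hdR' (abs_nonneg e)
            linarith
          exact_mod_cast this
        · simp only
          rw [div_eq_iff hdR.ne']
          push_cast
          linarith
      obtain ⟨v, hv⟩ := hN4 x
      have hxin : ∀ᶠ δ in 𝓝[>] (0:ℝ), x - δ ∈ unitI := by
        filter_upwards [small hx0] with δ hδ
        exact ⟨by linarith, by linarith⟩
      obtain ⟨γ, hγ⟩ : ∃ γ, ∃ᶠ δ in 𝓝[>] (0:ℝ), S (x - δ) = x - δ + γ := by
        by_contra hcon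
        push Not at hcon
        have hall : ∀ᶠ δ in 𝓝[>] (0:ℝ), ∀ γ ∈ C, S (x - δ) ≠ x - δ + γ := by
          rw [Filter.eventually_all_finite hC]
          intro γ _
          exact hcon γ
        obtain ⟨δ, h2, h3⟩ := (hall.and hxin).exists
        exact h2 _ (hCmem _ h3) (by ring)
      refine ⟨x + γ, ?_⟩
      obtain ⟨v', hv'⟩ := hN4 (x + γ)
      obtain ⟨δ0, hδ, hin, hNv, hNv', hpos⟩ :=
        (hγ.and_eventually (hxin.and (hv.and (hv'.and (small one_pos))))).exists
      have hSinδ := hSin _ hin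
      rw [hδ] at hSinδ
      have hrel := hSE _ hin
      rw [hδ, hNv] at hrel
      obtain ⟨hA, t, ht⟩ := hrel
      have hyy : x - δ0 + γ = x + γ - δ0 := by ring
      rw [hyy] at hA ht hSinδ
      rw [hNv'] at hA ht
      have hpos' : 0 < x + γ := by linarith [hSinδ.1]
      have hle1 : x + γ ≤ 1 := by
        by_contra hgt
        have hcl : ∃ᶠ δ in 𝓝[>] (0:ℝ), δ < x + γ - 1 ∧ x + γ - δ < 1 := by
          refine (hγ.and_eventually (hxin.and (small (sub_pos.mpr (not_le.mp hgt))))).mono ?_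
          rintro δ ⟨h1, h2, h3⟩
          have := (hSin _ h2).2
          rw [h1] at this
          exact ⟨h3.2, by linarith⟩
        obtain ⟨δ, h2, h3⟩ := hcl.exists
        linarith
      unfold LV
      filter_upwards [hxin, hv, hv', small hpos'] with δ f1 f2 f3 f4
      have hI : x + γ - δ ∈ unitI := ⟨by linarith, by linarith⟩
      refine huniq _ (hSin _ f1) _ hI _ _ (hSE _ f1) ?_
      rw [f2]
      refine ⟨by rw [f3]; exact hA, t, ?_⟩
      rw [f3]
      linarith

end backward

/-! ### Reduction to the permutation (321) -/

section reduction

theorem beta0 (lam : Fin 3 → ℝ) : betaPt lam 0 = 0 := by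
  simp [betaPt]

theorem beta1 (lam : Fin 3 → ℝ) : betaPt lam 1 = lam 0 := by
  simp [betaPt, Finset.sum_filter]

theorem beta2 (lam : Fin 3 → ℝ) : betaPt lam 2 = lam 0 + lam 1 := by
  simp [betaPt, Finset.sum_filter, Fin.sum_univ_three]

variable (π : Equiv.Perm (Fin 3)) (lam : Fin 3 → ℝ)

theorem ietMap_on (hpos : ∀ i, 0 < lam i) (j : Fin 3) (x : ℝ)
    (hx : x ∈ Set.Ico (betaPt lam (j : ℕ)) (betaPt lam (j : ℕ) + lam j)) :
    ietMap π lam x = x - betaPt lam (j : ℕ) +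
      ∑ i, if π i < π j then lam i else 0 := by
  have h : ∃ j : Fin 3, x ∈ Set.Ico (betaPt lam (j : ℕ)) (betaPt lam (j : ℕ) + lam j) := ⟨j, hx⟩
  unfold ietMap
  rw [dif_pos h]
  have key : h.choose = j := by
    have hc := h.choose_spec
    generalize h.choose = i at hc
    have p0 := hpos 0
    have p1 := hpos 1
    have p2 := hpos 2
    fin_cases i <;> fin_cases j <;>
      simp [beta0, beta1, beta2] at hc hx ⊢ <;> linarith
  rw [key, Finset.sum_filter]

theorem ietMap_out (hs : lam 0 + lam 1 + lam 2 = 1) (hpos : ∀ i, 0 < lam i) (x : ℝ)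
    (hx : x ∉ unitI) : ietMap π lam x = x := by
  unfold ietMap
  rw [dif_neg]
  rintro ⟨j, hj⟩
  apply hx
  have p0 := hpos 0
  have p1 := hpos 1
  have p2 := hpos 2
  unfold unitI
  fin_cases j <;> simp [beta0, beta1, beta2] at hj ⊢ <;> constructor <;> linarith

theorem ietMap_cases (hs : lam 0 + lam 1 + lam 2 = 1) (hpos : ∀ i, 0 < lam i) (x : ℝ)
    (hx : x ∈ unitI) :
    (x < lam 0 ∧ ietMap π lam x = x + ∑ i, if π i < π 0 then lam i else 0) ∨
    (lam 0 ≤ x ∧ x < lam 0 + lam 1 ∧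
      ietMap π lam x = x - lam 0 + ∑ i, if π i < π 1 then lam i else 0) ∨
    (lam 0 + lam 1 ≤ x ∧
      ietMap π lam x = x - (lam 0 + lam 1) + ∑ i, if π i < π 2 then lam i else 0) := by
  have hx0 : 0 ≤ x := hx.1
  have hx1 : x < 1 := hx.2
  by_cases h1 : x < lam 0
  · left
    refine ⟨h1, ?_⟩
    rw [ietMap_on π lam hpos 0 x (by simpa [beta0] using ⟨hx0, h1⟩)]
    simp [beta0]
  · by_cases h2 : x < lam 0 + lam 1
    · right; left
      refine ⟨not_lt.mp h1, h2, ?_⟩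
      rw [ietMap_on π lam hpos 1 x (by simpa [beta1] using ⟨not_lt.mp h1, h2⟩)]
      simp [beta1]
    · right; right
      refine ⟨not_lt.mp h2, ?_⟩
      rw [ietMap_on π lam hpos 2 x (by simpa [beta2] using ⟨not_lt.mp h2, by linarith⟩)]
      simp [beta2]

theorem no_fixed {T : ℝ → ℝ} (hmin : IsMinimal T) {x : ℝ} (hx : x ∈ unitI) (h : T x = x)
    (hinj : ∀ y, T y = x → y = x) : False := by
  apply not_finite_orbit hmin hx
  apply (Set.finite_singleton x).subset
  rintro y ⟨n, hn | hn⟩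
  · rw [Function.iterate_fixed h] at hn
    exact hn.symm
  · induction n generalizing y with
    | zero => exact hn
    | succ n ih =>
      rw [Function.iterate_succ_apply] at hn
      exact hinj _ (ih hn)

theorem perm_cases (π : Equiv.Perm (Fin 3)) :
    (π 0 = 0 ∧ π 1 = 1 ∧ π 2 = 2) ∨ (π 0 = 0 ∧ π 1 = 2 ∧ π 2 = 1) ∨
    (π 0 = 1 ∧ π 1 = 0 ∧ π 2 = 2) ∨ (π 0 = 1 ∧ π 1 = 2 ∧ π 2 = 0) ∨
    (π 0 = 2 ∧ π 1 = 0 ∧ π 2 = 1) ∨ (π 0 = 2 ∧ π 1 = 1 ∧ π 2 = 0) := by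
  revert π
  decide

theorem reduce (hs : lam 0 + lam 1 + lam 2 = 1) (hpos : ∀ i, 0 < lam i)
    (hmin : IsMinimal (ietMap π lam)) (hrot : ¬ IsRotationType (ietMap π lam)) :
    ietMap π lam = T3 (lam 0) (lam 1) (lam 2) (hpos 0) (hpos 1) (hpos 2) hs := by
  have p0 := hpos 0
  have p1 := hpos 1
  have p2 := hpos 2
  have hcs := ietMap_cases π lam hs hpos
  have hout := ietMap_out π lam hs hpos
  have fix0 : π 0 = 0 → False := by
    intro h0
    have h0I : (0:ℝ) ∈ unitI := ⟨le_refl _, by norm_num⟩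
    have q1 : (0 : Fin 3) < π 1 := by
      rw [Fin.pos_iff_ne_zero, ← h0]
      exact fun h => absurd (π.injective h) (by decide)
    have q2 : (0 : Fin 3) < π 2 := by
      rw [Fin.pos_iff_ne_zero, ← h0]
      exact fun h => absurd (π.injective h) (by decide)
    have nn : ∀ (P : Prop) [Decidable P] (i : Fin 3), 0 ≤ if P then lam i else 0 := by
      intro P _ i
      split_ifs
      · exact (hpos i).le
      · exact le_refl _
    simp only [Fin.sum_univ_three, h0, if_pos q1, if_pos q2, lt_irrefl, Fin.not_lt_zero, if_false] at hcs
    refine no_fixed hmin h0I ?_ ?_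
    · rcases hcs 0 h0I with ⟨h, h'⟩ | ⟨h, -⟩ | ⟨h, -⟩
      · linarith
      · linarith
      · linarith
    · intro y hy
      by_cases hyI : y ∈ unitI
      · rcases hcs y hyI with ⟨h, h'⟩ | ⟨h, h', h''⟩ | ⟨h, h'⟩
        · linarith
        · have := nn (π 2 < π 1) 2
          linarith
        · have := nn (π 1 < π 2) 1
          linarith
      · rw [hout y hyI] at hy
        exact hy
  rcases perm_cases π with ⟨e0, e1, e2⟩ | ⟨e0, e1, e2⟩ | ⟨e0, e1, e2⟩ | ⟨e0, e1, e2⟩ |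
    ⟨e0, e1, e2⟩ | ⟨e0, e1, e2⟩
  · exact (fix0 e0).elim
  · exact (fix0 e0).elim
  · exfalso
    simp [Fin.sum_univ_three, e0, e1, e2] at hcs
    have hI : lam 0 + lam 1 ∈ unitI := ⟨by linarith, by linarith⟩
    refine no_fixed hmin hI ?_ ?_
    · rcases hcs _ hI with ⟨h, h'⟩ | ⟨h, h', h''⟩ | ⟨h, h'⟩ <;> linarith
    · intro y hy
      by_cases hyI : y ∈ unitI
      · rcases hcs y hyI with ⟨h, h'⟩ | ⟨h, h', h''⟩ | ⟨h, h'⟩ <;> linarith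
      · rw [hout y hyI] at hy
        exact hy
  · exfalso
    simp [Fin.sum_univ_three, e0, e1, e2] at hcs
    apply hrot
    refine ⟨lam 2, fun x hx => ?_⟩
    have hx0 : 0 ≤ x := hx.1
    have hx1 : x < 1 := hx.2
    symm
    rw [Int.fract_eq_iff]
    rcases hcs x hx with ⟨h, h'⟩ | ⟨h, h', h''⟩ | ⟨h, h'⟩
    · exact ⟨by linarith, by linarith, 0, by push_cast; linarith⟩
    · exact ⟨by linarith, by linarith, 0, by push_cast; linarith⟩
    · exact ⟨by linarith, by linarith, 1, by push_cast; linarith⟩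
  · exfalso
    simp [Fin.sum_univ_three, e0, e1, e2] at hcs
    apply hrot
    refine ⟨-lam 0, fun x hx => ?_⟩
    have hx0 : 0 ≤ x := hx.1
    have hx1 : x < 1 := hx.2
    symm
    rw [Int.fract_eq_iff]
    rcases hcs x hx with ⟨h, h'⟩ | ⟨h, h', h''⟩ | ⟨h, h'⟩
    · exact ⟨by linarith, by linarith, -1, by push_cast; linarith⟩
    · exact ⟨by linarith, by linarith, 0, by push_cast; linarith⟩
    · exact ⟨by linarith, by linarith, 0, by push_cast; linarith⟩
  · simp [Fin.sum_univ_three, e0, e1, e2] at hcs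
    funext x
    by_cases hx : x ∈ unitI
    · rcases hcs x hx with ⟨h, h'⟩ | ⟨h, h', h''⟩ | ⟨h, h'⟩ <;>
      rcases T3_cases p0 p1 p2 hs hx with ⟨g, g'⟩ | ⟨g, g', g''⟩ | ⟨g, g'⟩ <;> linarith
    · rw [hout x hx, T3_not_mem p0 p1 p2 hs hx]

end reduction

theorem stmt2 (π : Equiv.Perm (Fin 3)) (lam : Fin 3 → ℝ)
    (hpos : ∀ i, 0 < lam i) (hsum : ∑ i, lam i = 1)
    (hmin : IsMinimal (ietMap π lam))
    (hrot : ¬ IsRotationType (ietMap π lam)) :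
    HasNontrivialRoot (ietMap π lam) ↔ ¬ SatisfiesIDOC lam (ietMap π lam) := by
  have hs : lam 0 + lam 1 + lam 2 = 1 := by rw [← hsum, Fin.sum_univ_three]
  have hT := reduce π lam hs hpos hmin hrot
  rw [hT] at hmin ⊢
  have p0 := hpos 0
  have p1 := hpos 1
  have p2 := hpos 2
  have haI : lam 0 ∈ unitI := ⟨by linarith, by linarith⟩
  have hbI : lam 0 + lam 1 ∈ unitI := ⟨by linarith, by linarith⟩
  have hap : ∀ x ∈ unitI, ∀ m : ℤ, (T3 (lam 0) (lam 1) (lam 2) p0 p1 p2 hs ^ m) x = x → m = 0 :=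
    fun x hx m h => aperiodic hmin hx m h
  constructor
  · rintro ⟨S, n, hS, hn, hST⟩ hidoc
    refine forward_aux p0 p1 p2 hs hap ?_ S n hS hn hST
    intro m hm
    have hd := hidoc.2 1 2 (by norm_num) (by norm_num) (by norm_num) (by norm_num) (by norm_num)
    rw [beta1, beta2] at hd
    have : lam 0 + lam 1 ∈ orbitZ (T3 (lam 0) (lam 1) (lam 2) p0 p1 p2 hs) (lam 0) ∩
        orbitZ (T3 (lam 0) (lam 1) (lam 2) p0 p1 p2 hs) (lam 0 + lam 1) :=
      ⟨(orbit_iff _ _ _).mpr ⟨m, hm⟩, (orbit_iff _ _ _).mpr ⟨0, by simp⟩⟩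
    rw [hd] at this
    exact this
  · intro hidoc
    obtain ⟨m, hm⟩ : ∃ m : ℤ, (T3 (lam 0) (lam 1) (lam 2) p0 p1 p2 hs ^ m) (lam 0)
        = lam 0 + lam 1 := by
      by_contra hcon
      push Not at hcon
      apply hidoc
      have hdis : orbitZ (T3 (lam 0) (lam 1) (lam 2) p0 p1 p2 hs) (lam 0) ∩
          orbitZ (T3 (lam 0) (lam 1) (lam 2) p0 p1 p2 hs) (lam 0 + lam 1) = ∅ := by
        rw [Set.eq_empty_iff_forall_notMem]
        rintro y ⟨h, h'⟩
        rw [orbit_iff] at h h'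
        obtain ⟨i, rfl⟩ := h
        obtain ⟨j, hj⟩ := h'
        apply hcon (-j + i)
        rw [zpow_add, Equiv.Perm.mul_apply, ← hj]
        simp
      constructor
      · intro j hj1 hj2
        apply not_finite_orbit hmin
        have : j = 1 ∨ j = 2 := by omega
        rcases this with rfl | rfl
        · rw [beta1]; exact haI
        · rw [beta2]; exact hbI
      · intro j j' hj1 hj2 hj1' hj2' hne
        have : (j = 1 ∧ j' = 2) ∨ (j = 2 ∧ j' = 1) := by omega
        rcases this with ⟨rfl, rfl⟩ | ⟨rfl, rfl⟩
        · rw [beta1, beta2]; exact hdis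
        · rw [beta1, beta2, Set.inter_comm]; exact hdis
    obtain ⟨u, v, huv⟩ := displacement p0 p1 p2 hs haI m
    rw [hm] at huv
    exact backward_aux p0 p1 p2 hs hap u v (by linarith)

end IETRoots
end

section
/- Let T be a minimal interval exchange transformation, and suppose that all the points of discontinuity of T belong to a single T-orbit. Then T is conjugate in the group 𝔾 of interval exchange transformations to a tower over a minimal rotation. -/
open Set

namespace IETRoots

/-- `z` is the first point of `Q ∪ {1}` strictly to the right of `y`. -/
def IsNext (Q : Set ℝ) (y z : ℝ) : Prop :=
  y < z ∧ z ≤ 1 ∧ (z = 1 ∨ z ∈ Q) ∧ ∀ w ∈ Q, y < w → z ≤ w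

def Pt (x : ℕ → ℝ) (N : ℕ) : Set ℝ := {w | ∃ i, i ≤ N ∧ x i = w}

def Pt' (x : ℕ → ℝ) (N : ℕ) : Set ℝ := {w | ∃ i, i ≤ N ∧ x (i + 1) = w}

theorem Pt_finite (x : ℕ → ℝ) (N : ℕ) : (Pt x N).Finite := by
  apply ((Set.finite_Iic N).image x).subset
  rintro w ⟨i, hi, rfl⟩
  exact ⟨i, hi, rfl⟩

theorem IsNext.unique {Q : Set ℝ} {y z z' : ℝ} (h : IsNext Q y z) (h' : IsNext Q y z') :
    z = z' := by
  obtain ⟨h1, h2, h3, h4⟩ := h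
  obtain ⟨h1', h2', h3', h4'⟩ := h'
  apply le_antisymm
  · rcases h3' with rfl | h3'
    · exact h2
    · exact h4 _ h3' h1'
  · rcases h3 with rfl | h3
    · exact h2'
    · exact h4' _ h3 h1

theorem IsNext.exists {Q : Set ℝ} (hQ : Q.Finite) {y : ℝ} (hy : y < 1) :
    ∃ z, IsNext Q y z := by
  have hf : (insert 1 {w ∈ Q | y < w ∧ w ≤ 1}).Finite :=
    (hQ.subset (fun w hw => hw.1)).insert 1
  obtain ⟨z, hz, hmin⟩ := Set.exists_min_image _ id hf ⟨1, Set.mem_insert _ _⟩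
  simp only [id] at hmin
  have hz1 : z ≤ 1 := hmin 1 (Set.mem_insert _ _)
  refine ⟨z, ?_, hz1, ?_, ?_⟩
  · rcases hz with rfl | hz
    · exact hy
    · exact hz.2.1
  · rcases hz with rfl | hz
    · exact Or.inl rfl
    · exact Or.inr hz.1
  · intro w hw hyw
    by_cases h : w ≤ 1
    · exact hmin w (Or.inr ⟨hw, hyw, h⟩)
    · linarith

structure Setup (T : ℝ → ℝ) (x : ℕ → ℝ) (N0 p : ℕ) (v : ℝ) : Prop where
  inj : Function.Injective T
  surj : ∀ y ∈ unitI, ∃ w ∈ unitI, T w = y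
  maps : ∀ y ∈ unitI, T y ∈ unitI
  step : ∀ i, T (x i) = x (i + 1)
  mem : ∀ i, x i ∈ unitI
  xinj : ∀ i j, x i = x j → i = j
  zero : ∃ i, i ≤ N0 ∧ x i = 0
  trans : ∀ N, N0 ≤ N → ∀ i, i ≤ N → ∀ z, IsNext (Pt x N) (x i) z →
    ∀ w ∈ Set.Ico (x i) z, T w = w + (x (i + 1) - x i)
  pN : p ≤ N0
  nextp : IsNext (Pt x N0) (x p) (x 0)
  next0 : IsNext (Pt x N0) (x 0) v

namespace Setup

variable {T : ℝ → ℝ} {x : ℕ → ℝ} {N0 p : ℕ} {v : ℝ}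

theorem ppos (h : Setup T x N0 p v) : 0 < p := by
  rcases Nat.eq_zero_or_pos p with hp | hp
  · have := h.nextp.1
    rw [hp] at this
    exact absurd this (lt_irrefl _)
  · exact hp

theorem cover (h : Setup T x N0 p v) {N : ℕ} (hN : N0 ≤ N) {y : ℝ} (hy : y ∈ unitI) :
    ∃ i, i ≤ N ∧ x i ≤ y ∧ ∀ z, IsNext (Pt x N) (x i) z → y < z := by
  have hf : {w ∈ Pt x N | w ≤ y}.Finite := (Pt_finite x N).subset (fun w hw => hw.1)
  obtain ⟨i0, hi0, hx0⟩ := h.zero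
  obtain ⟨w, hw, hmax⟩ := Set.exists_max_image _ id hf
    ⟨0, ⟨i0, hi0.trans hN, hx0⟩, hy.1⟩
  obtain ⟨⟨i, hi, rfl⟩, hwy⟩ := hw
  refine ⟨i, hi, hwy, fun z hz => ?_⟩
  by_contra hc
  push Not at hc
  rcases hz.2.2.1 with h1 | h1
  · have := hy.2
    linarith
  · have := hmax z ⟨h1, hc⟩
    simp only [id] at this
    linarith [hz.1]

theorem next_image (h : Setup T x N0 p v) {N : ℕ} (hN : N0 ≤ N) {i : ℕ} (hi : i ≤ N) {z : ℝ}
    (hz : IsNext (Pt x N) (x i) z) : IsNext (Pt' x N) (x (i + 1)) (x (i + 1) + (z - x i)) := by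
  have htr := h.trans N hN i hi z hz
  obtain ⟨h1, h2, h3, h4⟩ := hz
  have hxi := (h.mem i).1
  have hle : x (i + 1) + (z - x i) ≤ 1 := by
    by_contra hc
    push Not at hc
    set w := max (x i) (1 - x (i + 1) + x i) with hw
    have hwz : w < z := max_lt h1 (by linarith)
    have hwi : x i ≤ w := le_max_left _ _
    have hw2 : 1 - x (i + 1) + x i ≤ w := le_max_right _ _
    have := (h.maps w ⟨by linarith, by linarith⟩).2
    rw [htr w ⟨hwi, hwz⟩] at this
    linarith
  refine ⟨by linarith, hle, ?_, ?_⟩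
  · rcases hle.lt_or_eq with hlt | heq
    · right
      have hi1 := (h.mem (i + 1)).1
      obtain ⟨y, hy, hTy⟩ := h.surj (x (i + 1) + (z - x i)) ⟨by linarith, hlt⟩
      obtain ⟨j, hj, hjy, hjn⟩ := h.cover hN hy
      obtain ⟨zj, hzj⟩ := IsNext.exists (Pt_finite x N) (h.mem j).2
      have hyz := hjn zj hzj
      have htrj := h.trans N hN j hj zj hzj
      rcases hjy.lt_or_eq with hlt' | heq'
      · exfalso
        set δ := min (y - x j) (z - x i) with hδ
        have hδ0 : 0 < δ := lt_min (by linarith) (by linarith)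
        have hδ1 : δ ≤ y - x j := min_le_left _ _
        have hδ2 : δ ≤ z - x i := min_le_right _ _
        have e1 := htrj (y - δ) ⟨by linarith, by linarith⟩
        have e2 := htr (z - δ) ⟨by linarith, by linarith⟩
        have e3 := htrj y ⟨hjy, hyz⟩
        have : y - δ = z - δ := h.inj (by rw [e1, e2]; linarith)
        have hyz' : y = z := by linarith
        rcases h3 with h3 | h3
        · have := hy.2
          linarith
        · have := hzj.2.2.2 z h3 (by linarith)
          linarith
      · exact ⟨j, hj, by rw [← hTy, ← heq', h.step]⟩
    · exact Or.inl heq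
  · rintro w ⟨j, hj, rfl⟩ hlt
    by_contra hc
    push Not at hc
    have e := htr (x i + (x (j + 1) - x (i + 1))) ⟨by linarith, by linarith⟩
    have : x i + (x (j + 1) - x (i + 1)) = x j := h.inj (by rw [e, h.step]; ring)
    have := h4 (x j) ⟨j, hj, rfl⟩ (by linarith)
    linarith

theorem good_nextp (h : Setup T x N0 p v) {N : ℕ} (_hN : N0 ≤ N)
    (hg : ∀ n, N0 < n → n ≤ N → x n ∉ Set.Ico (x p) v) : IsNext (Pt x N) (x p) (x 0) := by
  obtain ⟨h1, h2, h3, h4⟩ := h.nextp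
  have hv := h.next0.1
  refine ⟨h1, h2, Or.inr ⟨0, Nat.zero_le _, rfl⟩, ?_⟩
  rintro w ⟨i, hi, rfl⟩ hw
  by_cases hi0 : i ≤ N0
  · exact h4 _ ⟨i, hi0, rfl⟩ hw
  · by_contra hc
    push Not at hc
    exact hg i (by omega) hi ⟨hw.le, hc.trans hv⟩

theorem good_next0 (h : Setup T x N0 p v) {N : ℕ} (hN : N0 ≤ N)
    (hg : ∀ n, N0 < n → n ≤ N → x n ∉ Set.Ico (x p) v) : IsNext (Pt x N) (x 0) v := by
  obtain ⟨h1, h2, h3, h4⟩ := h.next0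
  have hv := h.nextp.1
  refine ⟨h1, h2, ?_, ?_⟩
  · rcases h3 with h3 | ⟨i, hi, h3⟩
    · exact Or.inl h3
    · exact Or.inr ⟨i, hi.trans hN, h3⟩
  rintro w ⟨i, hi, rfl⟩ hw
  by_cases hi0 : i ≤ N0
  · exact h4 _ ⟨i, hi0, rfl⟩ hw
  · by_contra hc
    push Not at hc
    exact hg i (by omega) hi ⟨by linarith, hc⟩

theorem len_step (h : Setup T x N0 p v) {N : ℕ} (hN : N0 ≤ N)
    (hg : ∀ n, N0 < n → n ≤ N → x n ∉ Set.Ico (x p) v) {i : ℕ} (hi : i < N) (hip : i + 1 ≠ p)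
    {z z' : ℝ} (hz : IsNext (Pt x N) (x i) z) (hz' : IsNext (Pt x N) (x (i + 1)) z')
    (hq : x (N + 1) ∉ Set.Ico (x (i + 1)) z') : z' - x (i + 1) = z - x i := by
  have e1 := h.next_image hN hi.le hz
  have hp := h.good_nextp hN hg
  have e2 : IsNext (Pt' x N) (x (i + 1)) z' := by
    obtain ⟨h1, h2, h3, h4⟩ := hz'
    refine ⟨h1, h2, ?_, ?_⟩
    · rcases h3 with h3 | ⟨k, hk, h3⟩
      · exact Or.inl h3
      · right
        rcases k with _ | k
        · exfalso
          subst h3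
          have hne : x (i + 1) ≠ x p := fun hc => hip (h.xinj _ _ hc)
          rcases lt_or_gt_of_ne hne with hlt | hlt
          · have := h4 (x p) ⟨p, h.pN.trans hN, rfl⟩ hlt
            linarith [hp.1]
          · have := hp.2.2.2 (x (i + 1)) ⟨i + 1, hi, rfl⟩ hlt
            linarith
        · exact ⟨k, by omega, h3⟩
    · rintro w ⟨j, hj, rfl⟩ hw
      by_cases hjN : j + 1 ≤ N
      · exact h4 _ ⟨j + 1, hjN, rfl⟩ hw
      · have : j = N := by omega
        subst this
        by_contra hc
        push Not at hc
        exact hq ⟨hw.le, hc⟩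
  have := e1.unique e2
  linarith

/-- Existence of a return to the base interval. -/
theorem exists_return (h : Setup T x N0 p v) : ∃ n, N0 < n ∧ x n ∈ Set.Ico (x p) v := by
  by_contra hcon
  push Not at hcon
  have hpp := h.ppos
  have hpN := h.pN
  have hb : 0 < x 0 - x p := by linarith [h.nextp.1]
  set b := x 0 - x p with hbdef
  set N := N0 + ⌊1 / b⌋₊ + 2 with hNdef
  have hN : N0 ≤ N := by omega
  have hg : ∀ n, N0 < n → n ≤ N → x n ∉ Set.Ico (x p) v := fun n hn _ => hcon n hn
  have hnp := h.good_nextp hN hg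
  have hn0 := h.good_next0 hN hg
  have hz : ∀ i, ∃ z, IsNext (Pt x N) (x i) z :=
    fun i => IsNext.exists (Pt_finite x N) (h.mem i).2
  choose z hz using hz
  have hzp : z p = x 0 := (hz p).unique hnp
  have hz0 : z 0 = v := (hz 0).unique hn0
  obtain ⟨q, hqN, hq1, hq2⟩ := h.cover hN (h.mem (N + 1))
  replace hq2 := hq2 (z q) (hz q)
  have hdisj : ∀ j, j ≤ N → j ≠ q → x (N + 1) ∉ Set.Ico (x j) (z j) := by
    rintro j hj hjq ⟨hj1, hj2⟩
    rcases lt_or_gt_of_ne (fun hc => hjq (h.xinj _ _ hc)) with hlt | hlt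
    · have := (hz j).2.2.2 (x q) ⟨q, hqN, rfl⟩ hlt
      linarith
    · have := (hz q).2.2.2 (x j) ⟨j, hj, rfl⟩ hlt
      linarith
  have hK := hcon (N + 1) (by omega)
  have hqp : q ≠ p := by
    rintro rfl
    exact hK ⟨hq1, by linarith [hn0.1]⟩
  rcases lt_or_gt_of_ne hqp with hlt | hlt
  · -- all lengths from `p` on agree
    have hlen : ∀ k, p + k ≤ N → z (p + k) - x (p + k) = b := by
      intro k
      induction k with
      | zero => intro _; simp [hzp, hbdef]
      | succ k ih =>
        intro hk
        rw [← ih (by omega)]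
        exact h.len_step hN hg (i := p + k) (by omega) (by omega) (hz _) (hz _)
          (hdisj (p + k + 1) (by omega) (by omega))
    have hcard : (Finset.range (⌊1 / b⌋₊ + 1)).card < (Finset.Icc p N).card := by
      simp only [Finset.card_range, Nat.card_Icc]
      omega
    obtain ⟨i, hi, j, hj, hij, hf⟩ := Finset.exists_ne_map_eq_of_card_lt_of_maps_to hcard
      (f := fun i => ⌊x i / b⌋₊) (by
        intro i _
        simp only [Finset.coe_range, Set.mem_Iio]
        refine Nat.lt_succ_of_le (Nat.floor_le_floor ?_)
        exact div_le_div_of_nonneg_right (h.mem i).2.le hb.le)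
    simp only [Finset.mem_Icc] at hi hj hf
    have key : ∀ i j, p ≤ i → i ≤ N → j ≤ N → x i < x j → ⌊x i / b⌋₊ ≠ ⌊x j / b⌋₊ := by
      intro i j hpi hi hj hlt hfl
      have h1 := (hz i).2.2.2 (x j) ⟨j, hj, rfl⟩ hlt
      have h2 := hlen (i - p) (by omega)
      rw [Nat.add_sub_cancel' hpi] at h2
      have h3 : x i / b + 1 ≤ x j / b := by
        rw [div_add_one hb.ne']
        exact div_le_div_of_nonneg_right (by linarith) hb.le
      have h4 := Nat.lt_floor_add_one (x j / b)
      have h5 := Nat.floor_le (div_nonneg (h.mem i).1 hb.le)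
      rw [hfl] at h5
      linarith
    rcases lt_or_gt_of_ne (fun hc => hij (h.xinj _ _ hc)) with hl | hl
    · exact key i j hi.1 hi.2 hj.2 hl hf
    · exact key j i hj.1 hj.2 hi.2 hl hf.symm
  · have hlen : ∀ k, k < p → z k - x k = v - x 0 := by
      intro k
      induction k with
      | zero => intro _; rw [hz0]
      | succ k ih =>
        intro hk
        rw [← ih (by omega)]
        exact h.len_step hN hg (i := k) (by omega) (by omega) (hz _) (hz _)
          (hdisj (k + 1) (by omega) (by omega))
    have e := h.next_image hN (i := p - 1) (by omega) (hz _)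
    rw [hlen (p - 1) (by omega), Nat.sub_add_cancel hpp] at e
    obtain ⟨e1, e2, e3, e4⟩ := e
    have hv1 := hn0.2.1
    rcases e3 with e3 | ⟨j, hj, e3⟩
    · linarith
    · by_cases hjN : j + 1 ≤ N
      · have a1 := hnp.2.2.2 (x (j + 1)) ⟨j + 1, hjN, rfl⟩ (by linarith)
        rcases a1.lt_or_eq with a1 | a1
        · have := hn0.2.2.2 (x (j + 1)) ⟨j + 1, hjN, rfl⟩ a1
          linarith
        · have := h.xinj _ _ a1
          omega
      · have : j = N := by omega
        subst this
        exact hK ⟨by linarith, by linarith⟩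

/-- The final combinatorial structure. -/
theorem structure_thm (h : Setup T x N0 p v) : ∃ N, N0 ≤ N ∧ ∃ z : ℕ → ℝ,
    (∀ i, IsNext (Pt x N) (x i) (z i)) ∧ (∀ i, i < p → z i - x i = v - x 0) ∧
    (∀ i, p ≤ i → i ≤ N → z i - x i = x 0 - x p) ∧ x (N + 1) = x p + (v - x 0) := by
  classical
  have hex := h.exists_return
  have hpp := h.ppos
  have hpN := h.pN
  obtain ⟨hn1, hn2⟩ := Nat.find_spec hex
  have hnmin := fun m => @Nat.find_min _ _ hex m
  obtain ⟨N, hNn⟩ : ∃ N, Nat.find hex = N + 1 := ⟨Nat.find hex - 1, by omega⟩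
  rw [hNn] at hn1 hn2 hnmin
  have hN : N0 ≤ N := by omega
  have hg : ∀ n, N0 < n → n ≤ N → x n ∉ Set.Ico (x p) v :=
    fun n hn hnN hc => hnmin n (by omega) ⟨hn, hc⟩
  have hnp := h.good_nextp hN hg
  have hn0 := h.good_next0 hN hg
  have hz : ∀ i, ∃ z, IsNext (Pt x N) (x i) z :=
    fun i => IsNext.exists (Pt_finite x N) (h.mem i).2
  choose z hz using hz
  have hzp : z p = x 0 := (hz p).unique hnp
  have hz0 : z 0 = v := (hz 0).unique hn0
  have hdisj : ∀ j, j ≤ N → j ≠ 0 → j ≠ p → x (N + 1) ∉ Set.Ico (x j) (z j) := by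
    rintro j hj hj0 hjp ⟨hj1, hj2⟩
    have b1 : ¬ x p < x j := by
      intro hlt
      have a1 := hnp.2.2.2 (x j) ⟨j, hj, rfl⟩ hlt
      rcases a1.lt_or_eq with a1 | a1
      · have := hn0.2.2.2 (x j) ⟨j, hj, rfl⟩ a1
        linarith [hn2.2]
      · exact hj0 (h.xinj _ _ a1).symm
    have b2 : x j ≠ x p := fun hc => hjp (h.xinj _ _ hc)
    have b3 : x j < x p := lt_of_le_of_ne (not_lt.mp b1) b2
    have := (hz j).2.2.2 (x p) ⟨p, by omega, rfl⟩ b3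
    linarith [hn2.1]
  have hlen : ∀ k, k < p → z k - x k = v - x 0 := by
    intro k
    induction k with
    | zero => intro _; rw [hz0]
    | succ k ih =>
      intro hk
      rw [← ih (by omega)]
      exact h.len_step hN hg (i := k) (by omega) (by omega) (hz _) (hz _)
        (hdisj (k + 1) (by omega) (by omega) (by omega))
  have hlen' : ∀ k, p + k ≤ N → z (p + k) - x (p + k) = x 0 - x p := by
    intro k
    induction k with
    | zero => intro _; simp [hzp]
    | succ k ih =>
      intro hk
      rw [← ih (by omega)]
      exact h.len_step hN hg (i := p + k) (by omega) (by omega) (hz _) (hz _)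
        (hdisj (p + k + 1) (by omega) (by omega) (by omega))
  refine ⟨N, hN, z, hz, hlen, ?_, ?_⟩
  · intro i hi hiN
    have := hlen' (i - p) (by omega)
    rwa [Nat.add_sub_cancel' hi] at this
  · have e := h.next_image hN (i := p - 1) (by omega) (hz _)
    rw [hlen (p - 1) (by omega), Nat.sub_add_cancel hpp] at e
    obtain ⟨e1, e2, e3, e4⟩ := e
    have hv1 := hn0.2.1
    have hb : 0 < x 0 - x p := by linarith [h.nextp.1]
    rcases e3 with e3 | ⟨j, hj, e3⟩
    · linarith
    · by_cases hjN : j + 1 ≤ N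
      · have a1 := hnp.2.2.2 (x (j + 1)) ⟨j + 1, hjN, rfl⟩ (by linarith)
        rcases a1.lt_or_eq with a1 | a1
        · have := hn0.2.2.2 (x (j + 1)) ⟨j + 1, hjN, rfl⟩ a1
          linarith
        · have := h.xinj _ _ a1
          omega
      · have : j = N := by omega
        subst this
        exact e3

end Setup

/-- The rotation by `α` extended by the identity. -/
noncomputable def rot (α : ℝ) : ℝ → ℝ :=
  fun x => by classical exact if x ∈ unitI then Int.fract (x + α) else x

theorem rot_in (α : ℝ) {x : ℝ} (hx : x ∈ unitI) : rot α x = Int.fract (x + α) := by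
  simp [rot, hx]

theorem rot_out (α : ℝ) {x : ℝ} (hx : x ∉ unitI) : rot α x = x := by
  simp [rot, hx]

theorem fract_mem (x : ℝ) : Int.fract x ∈ unitI := ⟨Int.fract_nonneg x, Int.fract_lt_one x⟩

theorem fract_self {x : ℝ} (hx : x ∈ unitI) : Int.fract x = x := Int.fract_eq_self.mpr hx

theorem rot_iter (α : ℝ) (n : ℕ) {x : ℝ} (hx : x ∈ unitI) :
    (rot α)^[n] x = Int.fract (x + n * α) := by
  induction n with
  | zero => simp [fract_self hx]
  | succ n ih =>
    rw [Function.iterate_succ_apply', ih, rot_in α (fract_mem _), Int.fract_eq_fract]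
    refine ⟨-⌊x + n * α⌋, ?_⟩
    have := Int.self_sub_floor (x + n * α)
    rw [← this]
    push_cast
    ring

theorem rot_left {s x : ℝ} (_hs : s ∈ Set.Ioo (0 : ℝ) 1) (hx : x ∈ Set.Ico 0 s) :
    rot (1 - s) x = x + (1 - s) := by
  have h1 := hx.1
  have h2 := hx.2
  have h3 := _hs.2
  rw [rot_in _ ⟨h1, by linarith⟩]
  exact Int.fract_eq_self.mpr ⟨by linarith, by linarith⟩

theorem rot_right {s x : ℝ} (_hs : s ∈ Set.Ioo (0 : ℝ) 1) (hx : x ∈ Set.Ico s 1) :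
    rot (1 - s) x = x + (-s) := by
  have h1 := hx.1
  have h2 := hx.2
  have h3 := _hs.1
  rw [rot_in _ ⟨by linarith, h2⟩, Int.fract_eq_iff]
  exact ⟨by linarith, by linarith, 1, by push_cast; ring⟩

theorem rot_isIET {s : ℝ} (hs : s ∈ Set.Ioo (0 : ℝ) 1) : IsIET (rot (1 - s)) := by
  have h0 := hs.1
  have h1 := hs.2
  refine ⟨⟨?_, ?_, ?_⟩, fun x hx => rot_out _ hx, 2, ![0, s, 1], ?_, rfl, rfl, ?_⟩
  · intro x hx
    rw [rot_in _ hx]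
    exact fract_mem _
  · intro x hx y hy hxy
    rw [rot_in _ hx, rot_in _ hy, Int.fract_eq_fract] at hxy
    obtain ⟨z, hz⟩ := hxy
    have hz' : x - y = z := by linarith
    have a1 : (z : ℝ) < 1 := by linarith [hx.2, hy.1]
    have a2 : (-1 : ℝ) < z := by linarith [hx.1, hy.2]
    have a3 : z < 1 := by exact_mod_cast a1
    have a4 : -1 < z := by exact_mod_cast a2
    have : z = 0 := by omega
    rw [this] at hz'
    push_cast at hz'
    linarith
  · intro y hy
    refine ⟨Int.fract (y - (1 - s)), fract_mem _, ?_⟩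
    rw [rot_in _ (fract_mem _), ← fract_self hy, Int.fract_eq_fract]
    rw [fract_self hy]
    refine ⟨-⌊y - (1 - s)⌋, ?_⟩
    have := Int.self_sub_floor (y - (1 - s))
    rw [← this]
    push_cast
    ring
  · rw [Fin.strictMono_iff_lt_succ]
    intro i
    fin_cases i
    · simpa using h0
    · simpa using h1
  · intro i
    fin_cases i
    · exact ⟨1 - s, fun x hx => rot_left hs (by simpa using hx)⟩
    · exact ⟨-s, fun x hx => rot_right hs (by simpa using hx)⟩

theorem rot_minimal {α : ℝ} (hα : Irrational α) : IsMinimal (rot α) := by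
  intro x hx y hy
  rw [Metric.mem_closure_iff]
  intro ε hε
  have hd : Dense (AddSubgroup.closure {α, (1 : ℝ)} : Set ℝ) := by
    rw [dense_addSubgroupClosure_pair_iff]
    simpa using hα
  have hy1 := hy.1
  have hy2 := hy.2
  obtain ⟨w, hw, hwm⟩ := hd.exists_between (show y - x < min (y + ε) 1 - x by
    have : y < min (y + ε) 1 := lt_min (by linarith) hy2
    linarith)
  have hm1 := min_le_left (y + ε) 1
  have hm2 := min_le_right (y + ε) 1
  have hw1 := hwm.1
  have hw2 := hwm.2
  rw [SetLike.mem_coe, AddSubgroup.mem_closure_pair] at hw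
  obtain ⟨n, m, hnm⟩ := hw
  simp only [zsmul_eq_mul, mul_one] at hnm
  have hwu : x + w ∈ unitI := ⟨by linarith, by linarith⟩
  refine ⟨x + w, ?_, ?_⟩
  · rcases le_total 0 n with hn | hn
    · lift n to ℕ using hn
      refine ⟨n, Or.inl ?_⟩
      rw [rot_iter _ _ hx, ← fract_self hwu, Int.fract_eq_fract]
      refine ⟨-m, ?_⟩
      rw [← hnm]
      push_cast
      ring
    · obtain ⟨k, rfl⟩ : ∃ k : ℕ, n = -k := ⟨n.natAbs, by omega⟩
      refine ⟨k, Or.inr ?_⟩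
      rw [rot_iter _ _ hwu]
      nth_rewrite 2 [← fract_self hx]
      rw [Int.fract_eq_fract]
      refine ⟨m, ?_⟩
      rw [← hnm]
      push_cast
      ring
  · rw [Real.dist_eq, abs_lt]
    constructor <;> linarith

/-- Facts about a general IET. -/
theorem IsIET.injective {T : ℝ → ℝ} (hT : IsIET T) : Function.Injective T := by
  obtain ⟨⟨h1, h2, h3⟩, h4, -⟩ := hT
  intro a b hab
  by_cases ha : a ∈ unitI <;> by_cases hb : b ∈ unitI
  · exact h2 ha hb hab
  · have := h1 ha
    rw [hab, h4 b hb] at this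
    exact absurd this hb
  · have := h1 hb
    rw [← hab, h4 a ha] at this
    exact absurd this ha
  · rwa [h4 a ha, h4 b hb] at hab

theorem find_piece {k : ℕ} {β : Fin (k + 1) → ℝ} (h0 : β 0 = 0) (h1 : β (Fin.last k) = 1)
    {y : ℝ} (hy : y ∈ unitI) : ∃ i : Fin k, y ∈ Set.Ico (β i.castSucc) (β i.succ) := by
  by_contra hc
  push Not at hc
  have : ∀ i : Fin (k + 1), β i ≤ y := by
    intro i
    induction i using Fin.induction with
    | zero => rw [h0]; exact hy.1
    | succ i ih =>
      by_contra h
      push Not at h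
      exact hc i ⟨ih, h⟩
  have := this (Fin.last k)
  rw [h1] at this
  exact absurd hy.2 (not_lt.mpr this)

theorem IsIET.facts {T : ℝ → ℝ} (hT : IsIET T) :
    (∃ F : Set ℝ, F.Finite ∧ ∀ y ∈ unitI, T y - y ∈ F) ∧
    (∀ y ∈ unitI, ContinuousWithinAt T (Set.Ici y) y) ∧ (DiscSet T).Finite := by
  obtain ⟨-, -, k, β, hβ, h0, h1, hc⟩ := hT
  choose c hc using hc
  refine ⟨⟨Set.range c, Set.finite_range c, ?_⟩, ?_, ?_⟩
  · intro y hy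
    obtain ⟨i, hi⟩ := find_piece h0 h1 hy
    exact ⟨i, by rw [hc i y hi]; ring⟩
  · intro y hy
    obtain ⟨i, hi⟩ := find_piece h0 h1 hy
    have hcont : ContinuousWithinAt (fun w => w + c i) (Set.Ici y) y := by fun_prop
    refine hcont.congr_of_eventuallyEq ?_ (hc i y hi)
    have : Set.Ico y (β i.succ) ∈ nhdsWithin y (Set.Ici y) := Ico_mem_nhdsGE hi.2
    filter_upwards [this] with w hw
    exact hc i w ⟨hi.1.trans hw.1, hw.2⟩
  · apply (Set.finite_range β).subset
    rintro y ⟨hy, hd⟩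
    by_contra hr
    apply hd
    obtain ⟨i, hi⟩ := find_piece h0 h1 hy
    have hlt : β i.castSucc < y := lt_of_le_of_ne hi.1 (fun h => hr ⟨_, h⟩)
    have hcont : ContinuousAt (fun w => w + c i) y := by fun_prop
    apply ContinuousAt.continuousWithinAt
    refine hcont.congr ?_
    filter_upwards [Ioo_mem_nhds hlt hi.2] with w hw
    exact (hc i w ⟨hw.1.le, hw.2⟩).symm

theorem IsIET.trans_of_noDisc {T : ℝ → ℝ} (hT : IsIET T) {a b : ℝ} (ha : 0 ≤ a) (hb : b ≤ 1)
    (hd : ∀ d ∈ DiscSet T, ¬ (a < d ∧ d < b)) :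
    ∀ w ∈ Set.Ico a b, T w = w + (T a - a) := by
  obtain ⟨⟨F, hF, hFm⟩, hr, -⟩ := hT.facts
  intro w hw
  have hab : a < b := hw.1.trans_lt hw.2
  have hsub : Set.Ico a b ⊆ unitI := Set.Ico_subset_Ico ha hb
  have hcont : ContinuousOn (fun y => T y - y) (Set.Ico a b) := by
    apply ContinuousOn.sub _ continuousOn_id
    intro y hy
    rcases hy.1.lt_or_eq with hlt | rfl
    · by_contra hc
      apply hd y ⟨hsub hy, fun h => hc (h.mono hsub)⟩ ⟨hlt, hy.2⟩
    · exact (hr _ (hsub hy)).mono (fun z hz => hz.1)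
  have : Finite F := hF
  have := isPreconnected_Ico.constant_of_mapsTo (T := F) ⟨inferInstance⟩ hcont (fun y hy => hFm y (hsub hy))
    hw (show a ∈ Set.Ico a b from ⟨le_rfl, hab⟩)
  linarith

theorem iter_mem {T : ℝ → ℝ} (hT : IsIET T) {y : ℝ} (hy : y ∈ unitI) (n : ℕ) :
    T^[n] y ∈ unitI := by
  induction n with
  | zero => exact hy
  | succ n ih => rw [Function.iterate_succ_apply']; exact hT.1.1 ih

theorem aperiodic_s3 {T : ℝ → ℝ} (hT : IsIET T) (hmin : IsMinimal T) {y : ℝ} (hy : y ∈ unitI)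
    {m : ℕ} (hm : 0 < m) : T^[m] y ≠ y := by
  intro hper
  have hp : Function.IsPeriodicPt T m y := hper
  have hfin : (orbitZ T y).Finite := by
    apply ((Set.finite_Iio m).image (fun n => T^[n] y)).subset
    rintro w ⟨n, hn | hn⟩
    · exact ⟨n % m, Nat.mod_lt _ hm, by simp only; rw [hp.iterate_mod_apply, hn]⟩
    · have hmn : n ≤ m * n := Nat.le_mul_of_pos_left n hm
      have e : T^[m * n - n] y = w := by
        apply hT.injective.iterate n
        rw [← Function.iterate_add_apply, Nat.add_sub_cancel' hmn, hn]
        exact hp.mul_const n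
      exact ⟨(m * n - n) % m, Nat.mod_lt _ hm, by simp only; rw [hp.iterate_mod_apply, e]⟩
  have := hmin y hy
  rw [hfin.isClosed.closure_eq] at this
  exact (Set.Ico_infinite (zero_lt_one' ℝ)) (hfin.subset this)

theorem iter_inj {T : ℝ → ℝ} (hT : IsIET T) (hmin : IsMinimal T) {y : ℝ} (hy : y ∈ unitI)
    (i j : ℕ) (hij : T^[i] y = T^[j] y) : i = j := by
  by_contra hne
  wlog hlt : i < j generalizing i j
  · exact this j i hij.symm (Ne.symm hne) (by omega)
  apply aperiodic_s3 hT hmin hy (m := j - i) (by omega)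
  apply hT.injective.iterate i
  rw [← Function.iterate_add_apply, Nat.add_sub_cancel' hlt.le, hij]

theorem zero_image {T : ℝ → ℝ} (hT : IsIET T) (hmin : IsMinimal T) :
    ∃ d ∈ DiscSet T, T d = 0 := by
  obtain ⟨d, hd, hTd⟩ := hT.1.2.2 (show (0 : ℝ) ∈ unitI from ⟨le_rfl, zero_lt_one⟩)
  refine ⟨d, ⟨hd, fun hcont => ?_⟩, hTd⟩
  have hd0 : d ≠ 0 := by
    rintro rfl
    exact aperiodic_s3 hT hmin hd one_pos (by simpa using hTd)
  have hdpos : 0 < d := lt_of_le_of_ne hd.1 hd0.symm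
  -- `T` is a translation just to the left of `d`
  obtain ⟨-, -, hfin⟩ := hT.facts
  have hf : {w ∈ insert 0 (DiscSet T) | w < d}.Finite :=
    (hfin.insert 0).subset (fun w hw => hw.1)
  obtain ⟨a, ⟨ha, had⟩, hmax⟩ := Set.exists_max_image _ id hf ⟨0, Set.mem_insert _ _, hdpos⟩
  have ha0 : 0 ≤ a := hmax 0 ⟨Set.mem_insert _ _, hdpos⟩
  have htr := hT.trans_of_noDisc ha0 hd.2.le (b := d) (by
    rintro e he ⟨h1, h2⟩
    have := hmax e ⟨Set.mem_insert_of_mem _ he, h2⟩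
    simp only [id] at this
    linarith)
  have hsub : Set.Ico a d ⊆ unitI := Set.Ico_subset_Ico ha0 hd.2.le
  have hlim : Filter.Tendsto T (nhdsWithin d (Set.Ico a d)) (nhds 0) := by
    rw [← hTd]
    exact hcont.mono hsub
  have hlim2 : Filter.Tendsto (fun w => w + (T a - a)) (nhdsWithin d (Set.Ico a d))
      (nhds (d + (T a - a))) := by
    have : Continuous (fun w : ℝ => w + (T a - a)) := by fun_prop
    exact (this.tendsto d).mono_left nhdsWithin_le_nhds
  have : (nhdsWithin d (Set.Ico a d)).NeBot := by
    rw [← mem_closure_iff_nhdsWithin_neBot, closure_Ico had.ne]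
    exact ⟨had.le, le_rfl⟩
  have heq : d + (T a - a) = 0 := by
    refine tendsto_nhds_unique (hlim2.congr' ?_) hlim
    filter_upwards [self_mem_nhdsWithin] with w hw
    exact (htr w hw).symm
  have := (hT.1.1 (hsub ⟨le_rfl, had⟩)).1
  linarith

theorem exists_first {T : ℝ → ℝ} {D : Set ℝ} (hD : D.Finite) (hne : D.Nonempty)
    (horb : ∀ d ∈ D, ∀ d' ∈ D, d' ∈ orbitZ T d) :
    ∃ m ∈ D, ∀ d ∈ D, ∃ n : ℕ, T^[n] m = d := by
  have : ∀ s : Set ℝ, s.Finite → s ⊆ D → s.Nonempty → ∃ m ∈ s, ∀ d ∈ s, ∃ n : ℕ, T^[n] m = d := by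
    intro s hs
    induction s, hs using Set.Finite.induction_on with
    | empty => intro _ h; exact absurd h Set.not_nonempty_empty
    | @insert a s ha hs ih =>
      intro hsub _
      rcases s.eq_empty_or_nonempty with rfl | hsne
      · refine ⟨a, Set.mem_insert _ _, fun d hd => ⟨0, ?_⟩⟩
        simp at hd
        simp [hd]
      · obtain ⟨m, hm, hall⟩ := ih (fun x hx => hsub (Set.mem_insert_of_mem _ hx)) hsne
        obtain ⟨n, hn | hn⟩ := horb m (hsub (Set.mem_insert_of_mem _ hm)) a
          (hsub (Set.mem_insert _ _))
        · refine ⟨m, Set.mem_insert_of_mem _ hm, ?_⟩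
          rintro d (rfl | hd)
          · exact ⟨n, hn⟩
          · exact hall d hd
        · refine ⟨a, Set.mem_insert _ _, ?_⟩
          rintro d (rfl | hd)
          · exact ⟨0, rfl⟩
          · obtain ⟨n', hn'⟩ := hall d hd
            exact ⟨n' + n, by rw [Function.iterate_add_apply, hn, hn']⟩
  exact this D hD Set.Subset.rfl hne

theorem exists_setup {T : ℝ → ℝ} (hT : IsIET T) (hmin : IsMinimal T)
    (horb : ∀ d ∈ DiscSet T, ∀ d' ∈ DiscSet T, d' ∈ orbitZ T d) :
    ∃ x N0 p v, Setup T x N0 p v := by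
  obtain ⟨d0, hd0, hTd0⟩ := zero_image hT hmin
  obtain ⟨-, -, hfin⟩ := hT.facts
  obtain ⟨m, hm, hall⟩ := exists_first hfin ⟨d0, hd0⟩ horb
  choose! n hn using hall
  obtain ⟨B, hB⟩ := (hfin.image n).bddAbove
  have hmu : m ∈ unitI := hm.1
  set x : ℕ → ℝ := fun i => T^[i] m with hx
  have hxinj : ∀ i j, x i = x j → i = j := iter_inj hT hmin hmu
  have hxmem : ∀ i, x i ∈ unitI := iter_mem hT hmu
  have hstep : ∀ i, T (x i) = x (i + 1) := fun i => (Function.iterate_succ_apply' T i m).symm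
  have hle : ∀ d ∈ DiscSet T, n d ≤ B := fun d hd => hB ⟨d, hd, rfl⟩
  have hzero : x (n d0 + 1) = 0 := by
    rw [← hstep]
    simp only [hx]
    rw [hn d0 hd0, hTd0]
  have hx0 : 0 < x 0 := by
    refine lt_of_le_of_ne (hxmem 0).1 (fun hc => ?_)
    rw [← hzero] at hc
    have := hxinj _ _ hc
    omega
  have hz : ∃ i, i ≤ B + 1 ∧ x i = 0 := ⟨n d0 + 1, by have := hle d0 hd0; omega, hzero⟩
  -- predecessor of `x 0`
  have hf : {w ∈ Pt x (B + 1) | w < x 0}.Finite := (Pt_finite x _).subset (fun w hw => hw.1)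
  obtain ⟨u, ⟨⟨p, hp, rfl⟩, hu⟩, hmax⟩ := Set.exists_max_image _ id hf ⟨0, hz, hx0⟩
  obtain ⟨v, hv⟩ := IsNext.exists (Pt_finite x (B + 1)) (hxmem 0).2
  refine ⟨x, B + 1, p, v, ?_⟩
  refine ⟨hT.injective, hT.1.2.2, hT.1.1, hstep, hxmem, hxinj, hz, ?_, hp, ?_, hv⟩
  · intro N hN i hi z hz w hw
    rw [← hstep]
    refine hT.trans_of_noDisc (hxmem i).1 hz.2.1 ?_ w hw
    rintro d hd ⟨h1, h2⟩
    have := hz.2.2.2 d ⟨n d, by have := hle d hd; omega, hn d hd⟩ h1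
    linarith
  · refine ⟨hu, (hxmem 0).2.le, Or.inr ⟨0, Nat.zero_le _, rfl⟩, ?_⟩
    intro w hw hpw
    by_contra hc
    push Not at hc
    have := hmax w ⟨hw, hc⟩
    simp only [id] at this
    linarith

theorem id_isIET : IsIET id := by
  refine ⟨Set.bijOn_id _, fun _ _ => rfl, 1, ![0, 1], ?_, rfl, rfl, ?_⟩
  · rw [Fin.strictMono_iff_lt_succ]
    intro i
    fin_cases i
    simp
  · intro i
    exact ⟨0, fun x _ => by simp⟩

theorem stmt3 (T : ℝ → ℝ) (hT : IsIET T) (hmin : IsMinimal T)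
    (horb : ∀ d ∈ DiscSet T, ∀ d' ∈ DiscSet T, d' ∈ orbitZ T d) :
    ∃ (S T' : ℝ → ℝ) (n : Fin 2 → ℕ),
      IsRotation S ∧ IsMinimal S ∧ IsTowerOver T' n S ∧ IsConjugate T T' := by
  obtain ⟨x, N0, p, v, h⟩ := exists_setup hT hmin horb
  obtain ⟨N, hN, z, hz, hl0, hlp, hxN⟩ := h.structure_thm
  have hpp := h.ppos
  have hpN := h.pN
  have hpx := h.nextp.1
  have hxv := h.next0.1
  set c := v - x p with hc
  have hcpos : 0 < c := by linarith
  set s := (x 0 - x p) / c with hs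
  have hcs : c * s = x 0 - x p := by rw [hs]; field_simp
  have hcs' : c * (1 - s) = v - x 0 := by rw [mul_sub, hcs]; linarith
  have hs0 : 0 < s := div_pos (by linarith) hcpos
  have hs1 : s < 1 := by rw [hs, div_lt_one hcpos]; linarith
  have hsm : s ∈ Set.Ioo (0 : ℝ) 1 := ⟨hs0, hs1⟩
  -- translation along levels
  have htr : ∀ i, i ≤ N → ∀ y, 0 ≤ y → y < z i - x i → T (x i + y) = x (i + 1) + y := by
    intro i hi y hy0 hy1
    rw [h.trans N hN i hi (z i) (hz i) (x i + y) ⟨by linarith, by linarith⟩]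
    ring
  have htopR : ∀ y ∈ Set.Ico s 1, T (x (p - 1) + c * (y - s)) = x p + c * rot (1 - s) y := by
    intro y hy
    rw [rot_right hsm hy]
    have e := htr (p - 1) (by omega) (c * (y - s))
      (mul_nonneg hcpos.le (by linarith [hy.1])) (by
        rw [hl0 (p - 1) (by omega), ← hcs']
        exact mul_lt_mul_of_pos_left (by linarith [hy.2]) hcpos)
    rw [e, Nat.sub_add_cancel hpp]
    ring
  have htopL : ∀ y ∈ Set.Ico 0 s, T (x N + c * y) = x p + c * rot (1 - s) y := by
    intro y hy
    rw [rot_left hsm hy]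
    have e := htr N le_rfl (c * y) (mul_nonneg hcpos.le hy.1) (by
        rw [hlp N (by omega) le_rfl, ← hcs]
        exact mul_lt_mul_of_pos_left hy.2 hcpos)
    rw [e, hxN, mul_add, hcs']
    ring
  -- iterating along a column
  have hcol : ∀ i k, i + k ≤ N + 1 → ∀ y, 0 ≤ y →
      (∀ j, i ≤ j → j < i + k → y < z j - x j) → T^[k] (x i + y) = x (i + k) + y := by
    intro i k
    induction k with
    | zero => intros; rfl
    | succ k ih =>
      intro hk y hy0 hy
      rw [Function.iterate_succ_apply', ih (by omega) y hy0 (fun j h1 h2 => hy j h1 (by omega)),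
        htr (i + k) (by omega) y hy0 (hy _ (by omega) (by omega))]
      rfl
  have hret : ∀ y ∈ unitI, ∃ m : ℕ, 0 < m ∧ T^[m] (x p + c * y) = x p + c * rot (1 - s) y := by
    intro y hy
    rcases lt_or_ge y s with hlt | hge
    · refine ⟨N - p + 1, by omega, ?_⟩
      rw [Function.iterate_succ_apply', hcol p (N - p) (by omega) (c * y)
        (mul_nonneg hcpos.le hy.1), Nat.add_sub_cancel' (by omega), htopL y ⟨hy.1, hlt⟩]
      intro j hj1 hj2
      rw [hlp j hj1 (by omega), ← hcs]
      exact mul_lt_mul_of_pos_left hlt hcpos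
    · refine ⟨p - 1 + 1, by omega, ?_⟩
      have e : x p + c * y = x 0 + c * (y - s) := by rw [mul_sub, hcs]; ring
      rw [Function.iterate_succ_apply', e, hcol 0 (p - 1) (by omega) (c * (y - s))
        (mul_nonneg hcpos.le (by linarith)), Nat.zero_add, htopR y ⟨hge, hy.2⟩]
      intro j hj1 hj2
      rw [hl0 j (by omega), ← hcs']
      exact mul_lt_mul_of_pos_left (by linarith [hy.2]) hcpos
  have h0u : (0 : ℝ) ∈ unitI := ⟨le_rfl, zero_lt_one⟩
  have hiter : ∀ k : ℕ, ∃ m : ℕ, k ≤ m ∧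
      T^[m] (x p) = x p + c * (rot (1 - s))^[k] 0 := by
    intro k
    induction k with
    | zero => exact ⟨0, le_rfl, by simp⟩
    | succ k ih =>
      obtain ⟨m, hm, e⟩ := ih
      have hu : (rot (1 - s))^[k] 0 ∈ unitI := iter_mem (rot_isIET hsm) h0u k
      obtain ⟨m', hm', e'⟩ := hret _ hu
      refine ⟨m' + m, by omega, ?_⟩
      rw [Function.iterate_add_apply, e, e', Function.iterate_succ_apply']
  have hirr : Irrational (1 - s) := by
    rintro ⟨q, hq⟩
    obtain ⟨m, hm, e⟩ := hiter q.den
    rw [rot_iter _ _ h0u, ← hq] at e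
    have : (0 : ℝ) + (q.den : ℝ) * (q : ℝ) = (q.num : ℝ) := by
      rw [zero_add, mul_comm]
      exact_mod_cast Rat.mul_den_eq_num q
    rw [this, Int.fract_intCast, mul_zero, add_zero] at e
    exact aperiodic_s3 hT hmin (h.mem p) (lt_of_lt_of_le q.den_pos hm) e
  -- index of levels
  let t : Fin 3 → ℝ := ![0, s, 1]
  let a : Fin 2 → ℕ → ℝ := ![fun j => x (p + j), fun j => x j]
  let n : Fin 2 → ℕ := ![N + 1 - p, p]
  let ix : Fin 2 → ℕ → ℕ := ![fun j => p + j, fun j => j]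
  have ha : ∀ i j, a i j = x (ix i j) := by
    intro i j
    fin_cases i <;> rfl
  have hixN : ∀ i j, j < n i → ix i j ≤ N := by
    intro i j hj
    fin_cases i
    · change j < N + 1 - p at hj
      change p + j ≤ N
      omega
    · change j < p at hj
      change j ≤ N
      omega
  have hwid : ∀ i j, j < n i → a i j + c * (t i.succ - t i.castSucc) = z (ix i j) := by
    intro i j hj
    fin_cases i
    · change j < N + 1 - p at hj
      change x (p + j) + c * (s - 0) = z (p + j)
      rw [sub_zero, hcs, ← hlp (p + j) (by omega) (by omega)]
      ring
    · change j < p at hj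
      change x j + c * (1 - s) = z j
      rw [hcs', ← hl0 j hj]
      ring
  have hixinj : ∀ i i' j j', j < n i → j' < n i' → ix i j = ix i' j' → (i, j) = (i', j') := by
    intro i i' j j' hj hj' he
    fin_cases i <;> fin_cases i'
    · change p + j = p + j' at he
      have : j = j' := by omega
      rw [this]
    · change p + j = j' at he
      change j' < p at hj'
      omega
    · change j = p + j' at he
      change j < p at hj
      omega
    · change j = j' at he
      rw [he]
  refine ⟨rot (1 - s), T, n, ⟨fun y hy => rot_out _ hy, 1 - s, ⟨by linarith, by linarith⟩,
    fun y hy => rot_in _ hy⟩, rot_minimal hirr, ⟨hT, rot_isIET hsm, ?_, t, c, a, ?_, rfl, rfl,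
    hcpos, ?_, ?_, ?_, ?_, ?_, ?_⟩, id, id_isIET, rfl⟩
  · intro i
    fin_cases i
    · change 0 < N + 1 - p
      omega
    · exact hpp
  · rw [Fin.strictMono_iff_lt_succ]
    intro i
    fin_cases i
    · exact hs0
    · exact hs1
  · intro i
    fin_cases i
    · exact ⟨1 - s, fun y hy => rot_left hsm hy⟩
    · exact ⟨-s, fun y hy => rot_right hsm hy⟩
  · intro i j hj
    rw [hwid i j hj, ha]
    exact Set.Ico_subset_Ico (h.mem _).1 (hz _).2.1
  · intro i i' j j' hj hj' hne
    rw [hwid i j hj, hwid i' j' hj', ha, ha, Set.disjoint_left]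
    rintro y ⟨h1, h2⟩ ⟨h3, h4⟩
    have hne' : x (ix i j) ≠ x (ix i' j') :=
      fun he => hne (hixinj i i' j j' hj hj' (h.xinj _ _ he))
    rcases lt_or_gt_of_ne hne' with hlt | hlt
    · have := (hz (ix i j)).2.2.2 _ ⟨ix i' j', hixN _ _ hj', rfl⟩ hlt
      linarith
    · have := (hz (ix i' j')).2.2.2 _ ⟨ix i j, hixN _ _ hj, rfl⟩ hlt
      linarith
  · intro y hy
    obtain ⟨q, hq, hq1, hq2⟩ := h.cover hN hy
    have hq3 := hq2 (z q) (hz q)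
    rcases lt_or_ge q p with hlt | hge
    · refine ⟨1, q, hlt, ?_⟩
      rw [hwid 1 q hlt]
      exact ⟨hq1, hq3⟩
    · have hlt : q - p < n 0 := by
        change q - p < N + 1 - p
        omega
      have e : ix 0 (q - p) = q := by
        change p + (q - p) = q
        omega
      refine ⟨0, q - p, hlt, ?_⟩
      rw [hwid 0 _ hlt, ha, e]
      exact ⟨hq1, hq3⟩
  · intro i j hj y hy
    have hw := hwid i j (by omega)
    rw [ha] at hw ⊢
    have e : a i (j + 1) = x (ix i j + 1) := by
      rw [ha]
      fin_cases i <;> rfl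
    rw [e]
    refine htr _ (hixN i j (by omega)) _ (mul_nonneg hcpos.le (by linarith [hy.1])) ?_
    rw [← hw, add_sub_cancel_left]
    exact mul_lt_mul_of_pos_left (by linarith [hy.2]) hcpos
  · intro i y hy i' hi'
    have e : a i' 0 + c * (rot (1 - s) y - t i'.castSucc) = x p + c * rot (1 - s) y := by
      fin_cases i'
      · change x (p + 0) + c * (rot (1 - s) y - 0) = _
        simp
      · change x 0 + c * (rot (1 - s) y - s) = _
        rw [mul_sub, hcs]
        ring
    rw [e]
    fin_cases i
    · change T (x (p + (N + 1 - p - 1)) + c * (y - 0)) = _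
      have : p + (N + 1 - p - 1) = N := by omega
      rw [this, sub_zero]
      exact htopL y hy
    · exact htopR y hy

end IETRoots
end
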